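/- arXiv:1310.6152 — 3 statements merged into one kernel-verified Lean document; each statement's English description precedes it below -/
import Mathlib

section
/- Let G be a nontrivial connected graph with a distinguished vertex w, and for nonnegative integers p, q let G(p,q) denote the graph obtained from G by attaching two pendant paths w v_1 v_2 ⋯ v_p and w u_1 u_2 ⋯ u_q at w. If p ≥ q ≥ 1, then ϱ(G(p+1, q−1)) > ϱ(G(p,q)), where ϱ denotes the distance spectral radius. -/
open SimpleGraph

/-- The distance matrix of a graph: the (i,j)-entry is the graph distance between i and j. -/
noncomputable def distMatrix {V : Type*} [Fintype V] (G : SimpleGraph V) : Matrix V V ℝ :=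
  fun i j => (G.dist i j : ℝ)

/-- The distance spectral radius: the largest eigenvalue of the distance matrix. -/
noncomputable def distSpectralRadius {V : Type*} [Fintype V] (G : SimpleGraph V) : ℝ :=
  sSup {μ : ℝ | ∃ X : V → ℝ, X ≠ 0 ∧ (distMatrix G).mulVec X = μ • X}

/-- The distance Perron vector: the positive unit eigenvector of the distance matrix
corresponding to the distance spectral radius. -/
def IsDistPerronVector {V : Type*} [Fintype V] (G : SimpleGraph V) (X : V → ℝ) : Prop :=
  (∀ v, 0 < X v) ∧ (∑ v, (X v) ^ 2 = 1) ∧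
    (distMatrix G).mulVec X = distSpectralRadius G • X

/-- The graph obtained from `G` by attaching at `w` two pendant paths, of `p` and `q`
new vertices respectively. -/
def attachPaths {V : Type*} (G : SimpleGraph V) (w : V) (p q : ℕ) :
    SimpleGraph (V ⊕ (Fin p ⊕ Fin q)) :=
  SimpleGraph.fromRel (fun a b =>
    match a, b with
    | Sum.inl x, Sum.inl y => G.Adj x y
    | Sum.inl x, Sum.inr (Sum.inl i) => x = w ∧ (i : ℕ) = 0
    | Sum.inl x, Sum.inr (Sum.inr i) => x = w ∧ (i : ℕ) = 0
    | Sum.inr (Sum.inl i), Sum.inr (Sum.inl j) => (i : ℕ) + 1 = (j : ℕ)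
    | Sum.inr (Sum.inr i), Sum.inr (Sum.inr j) => (i : ℕ) + 1 = (j : ℕ)
    | _, _ => False)

/-- In `attachPaths G w (k-1) k`, the vertex `v_i` (1-based index `i = (·:ℕ)+1`):
`v_1` is the attachment vertex `w` itself, and `v_2, …, v_k` are the `k-1` new
vertices of the shorter arm. -/
def armV {V : Type*} (w : V) (k : ℕ) (i : Fin k) : V ⊕ (Fin (k - 1) ⊕ Fin k) :=
  if _h : (i : ℕ) = 0 then Sum.inl w
  else Sum.inr (Sum.inl ⟨(i : ℕ) - 1, by have := i.isLt; omega⟩)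

/-- In `attachPaths G w (k-1) k`, the vertex `u_i` (1-based index `i = (·:ℕ)+1`) of the
longer arm. -/
def armU {V : Type*} (_w : V) (k : ℕ) (i : Fin k) : V ⊕ (Fin (k - 1) ⊕ Fin k) :=
  Sum.inr (Sum.inr i)


section Aux

/-- Characterisation of the graph distance by local conditions. -/
theorem aux_dist_eq {W : Type*} (H : SimpleGraph W) (d : W → W → ℕ)
    (h0 : ∀ x, d x x = 0)
    (hlip : ∀ x y z, H.Adj x z → d x y ≤ d z y + 1)
    (hstep : ∀ x y, x ≠ y → ∃ z, H.Adj x z ∧ d z y + 1 = d x y) (x y : W) :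
    H.dist x y = d x y := by
  have hup : ∀ n x y, d x y = n → ∃ p : H.Walk x y, p.length = n := by
    intro n
    induction n with
    | zero =>
      intro x y h
      by_cases hxy : x = y
      · subst hxy
        exact ⟨Walk.nil, rfl⟩
      · obtain ⟨z, _, hz⟩ := hstep x y hxy
        omega
    | succ n ih =>
      intro x y h
      by_cases hxy : x = y
      · subst hxy
        rw [h0] at h
        omega
      · obtain ⟨z, hz, hd⟩ := hstep x y hxy
        obtain ⟨p, hp⟩ := ih z y (by omega)
        exact ⟨Walk.cons hz p, by simp [hp]⟩
  have hlow : ∀ x y (p : H.Walk x y), d x y ≤ p.length := by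
    intro x y p
    induction p with
    | nil => simp [h0]
    | cons h p ih =>
      have := fun y => hlip _ y _ h
      rw [Walk.length_cons]
      exact (this _).trans (Nat.add_le_add_right ih 1)
  obtain ⟨p, hp⟩ := hup _ x y rfl
  apply le_antisymm
  · rw [← hp]; exact SimpleGraph.dist_le p
  · obtain ⟨p', hp'⟩ := (Walk.reachable p).exists_walk_length_eq_dist
    rw [← hp']; exact hlow _ _ p'

/-- Stepping towards a target in a connected graph. -/
theorem aux_step {V : Type*} (G : SimpleGraph V) (hG : G.Connected) (x y : V) (hxy : x ≠ y) :
    ∃ z, G.Adj x z ∧ G.dist z y + 1 = G.dist x y := by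
  obtain ⟨p, hp⟩ := hG.exists_walk_length_eq_dist x y
  cases p with
  | nil => exact absurd rfl hxy
  | cons h p =>
    rename_i z
    refine ⟨z, h, ?_⟩
    rw [Walk.length_cons] at hp
    have h1 := SimpleGraph.dist_le p
    have h2 := hG.dist_triangle (u := x) (v := z) (w := y)
    rw [SimpleGraph.dist_eq_one_iff_adj.mpr h] at h2
    omega

theorem aux_lip {V : Type*} (G : SimpleGraph V) (hG : G.Connected) (x y z : V)
    (h : G.Adj x z) : G.dist x y ≤ G.dist z y + 1 := by
  have h2 := hG.dist_triangle (u := x) (v := z) (w := y)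
  rw [SimpleGraph.dist_eq_one_iff_adj.mpr h] at h2
  omega

/-- Explicit distance in `attachPaths`. -/
noncomputable def auxD {V : Type*} (G : SimpleGraph V) (w : V) (p q : ℕ) :
    V ⊕ (Fin p ⊕ Fin q) → V ⊕ (Fin p ⊕ Fin q) → ℕ
  | Sum.inl x, Sum.inl y => G.dist x y
  | Sum.inl x, Sum.inr (Sum.inl i) => G.dist x w + i + 1
  | Sum.inl x, Sum.inr (Sum.inr i) => G.dist x w + i + 1
  | Sum.inr (Sum.inl i), Sum.inl x => G.dist x w + i + 1
  | Sum.inr (Sum.inr i), Sum.inl x => G.dist x w + i + 1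
  | Sum.inr (Sum.inl i), Sum.inr (Sum.inl j) => (i - j) + (j - i)
  | Sum.inr (Sum.inr i), Sum.inr (Sum.inr j) => (i - j) + (j - i)
  | Sum.inr (Sum.inl i), Sum.inr (Sum.inr j) => i + j + 2
  | Sum.inr (Sum.inr i), Sum.inr (Sum.inl j) => i + j + 2

theorem aux_dist {V : Type*} (G : SimpleGraph V) (hG : G.Connected) (w : V) (p q : ℕ)
    (a b : V ⊕ (Fin p ⊕ Fin q)) : (attachPaths G w p q).dist a b = auxD G w p q a b := by
  apply aux_dist_eq
  · rintro (x | i | i) <;> simp [auxD]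
  · rintro (x | i | i) (y | j | j) (z | k | k) h <;>
      simp only [attachPaths, fromRel_adj, ne_eq, reduceCtorEq, not_false_eq_true, true_and,
        or_self, or_false, false_or, and_false, Sum.inl.injEq, Sum.inr.injEq] at h <;>
      simp only [auxD]
    all_goals first
      | omega
      | exact aux_lip G hG _ _ _ (h.2.elim id fun h => h.symm)
      | (have := aux_lip G hG x w z (h.2.elim id fun h => h.symm)
         omega)
      | (obtain ⟨hx, h⟩ := h
         have h1 := G.dist_comm (u := w) (v := y)
         rw [hx]
         omega)
      | (obtain ⟨hx, h⟩ := h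
         have h1 : G.dist w w = 0 := SimpleGraph.dist_self
         rw [hx]
         omega)
  · have hw0 : G.dist w w = 0 := SimpleGraph.dist_self
    rintro (x | i | i) (y | j | j) h
    · obtain ⟨z, hz, hd⟩ := aux_step G hG x y (by simpa using h)
      exact ⟨Sum.inl z, by simp [attachPaths, hz, hz.ne], hd⟩
    · by_cases hx : x = w
      · subst hx
        exact ⟨Sum.inr (Sum.inl ⟨0, j.pos⟩), by simp [attachPaths], by simp [auxD]⟩
      · obtain ⟨z, hz, hd⟩ := aux_step G hG x w hx
        exact ⟨Sum.inl z, by simp [attachPaths, hz, hz.ne], by simp only [auxD]; omega⟩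
    · by_cases hx : x = w
      · subst hx
        exact ⟨Sum.inr (Sum.inr ⟨0, j.pos⟩), by simp [attachPaths], by simp [auxD]⟩
      · obtain ⟨z, hz, hd⟩ := aux_step G hG x w hx
        exact ⟨Sum.inl z, by simp [attachPaths, hz, hz.ne], by simp only [auxD]; omega⟩
    · by_cases hi : (i : ℕ) = 0
      · exact ⟨Sum.inl w, by simp [attachPaths, hi], by
          simp only [auxD, G.dist_comm (u := w)]; omega⟩
      · exact ⟨Sum.inr (Sum.inl ⟨i - 1, by omega⟩), by
          simp [attachPaths, Fin.ext_iff]; omega, by simp only [auxD]; omega⟩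
    · have hij : (i : ℕ) ≠ j := by simpa [Fin.ext_iff] using h
      by_cases hi : (i : ℕ) < j
      · exact ⟨Sum.inr (Sum.inl ⟨i + 1, by omega⟩), by
          simp [attachPaths, Fin.ext_iff], by simp only [auxD]; omega⟩
      · exact ⟨Sum.inr (Sum.inl ⟨i - 1, by omega⟩), by
          simp [attachPaths, Fin.ext_iff]; omega, by simp only [auxD]; omega⟩
    · by_cases hi : (i : ℕ) = 0
      · exact ⟨Sum.inl w, by simp [attachPaths, hi], by
          simp only [auxD]; omega⟩
      · exact ⟨Sum.inr (Sum.inl ⟨i - 1, by omega⟩), by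
          simp [attachPaths, Fin.ext_iff]; omega, by simp only [auxD]; omega⟩
    · by_cases hi : (i : ℕ) = 0
      · exact ⟨Sum.inl w, by simp [attachPaths, hi], by
          simp only [auxD, G.dist_comm (u := w)]; omega⟩
      · exact ⟨Sum.inr (Sum.inr ⟨i - 1, by omega⟩), by
          simp [attachPaths, Fin.ext_iff]; omega, by simp only [auxD]; omega⟩
    · by_cases hi : (i : ℕ) = 0
      · exact ⟨Sum.inl w, by simp [attachPaths, hi], by
          simp only [auxD]; omega⟩
      · exact ⟨Sum.inr (Sum.inr ⟨i - 1, by omega⟩), by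
          simp [attachPaths, Fin.ext_iff]; omega, by simp only [auxD]; omega⟩
    · have hij : (i : ℕ) ≠ j := by simpa [Fin.ext_iff] using h
      by_cases hi : (i : ℕ) < j
      · exact ⟨Sum.inr (Sum.inr ⟨i + 1, by omega⟩), by
          simp [attachPaths, Fin.ext_iff], by simp only [auxD]; omega⟩
      · exact ⟨Sum.inr (Sum.inr ⟨i - 1, by omega⟩), by
          simp [attachPaths, Fin.ext_iff]; omega, by simp only [auxD]; omega⟩

open Matrix in
/-- Perron-type lemma for the distance spectral radius. -/
theorem aux_perron {W : Type*} [Fintype W] [Nonempty W] (H : SimpleGraph W) :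
    (∃ x : W → ℝ, (∀ v, 0 ≤ x v) ∧ x ≠ 0 ∧
      (distMatrix H) *ᵥ x = distSpectralRadius H • x) ∧
    (∀ y : W → ℝ, y ⬝ᵥ (distMatrix H *ᵥ y) ≤ distSpectralRadius H * (y ⬝ᵥ y)) := by
  classical
  set D := distMatrix H with hD
  have hD0 : ∀ i j, 0 ≤ D i j := fun i j => Nat.cast_nonneg _
  have hDs : D.IsHermitian := by
    ext i j
    simp [hD, distMatrix, Matrix.conjTranspose_apply, H.dist_comm (u := i)]
  let S : Set (W → ℝ) := {y | y ⬝ᵥ y = 1}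
  let f : (W → ℝ) → ℝ := fun y => y ⬝ᵥ (D *ᵥ y)
  have hf : Continuous f := by
    simp only [f, dotProduct, mulVec]; fun_prop
  have hScl : IsClosed S := by
    apply isClosed_eq _ continuous_const
    simp only [dotProduct]; fun_prop
  have hSb : S ⊆ Set.Icc (fun _ => -1) (fun _ => 1) := by
    intro y hy
    have hy' : ∑ i, y i * y i = 1 := hy
    have : ∀ i, y i * y i ≤ 1 := fun i => by
      rw [← hy']
      exact Finset.single_le_sum (f := fun i => y i * y i) (fun i _ => mul_self_nonneg _) (Finset.mem_univ i)
    exact ⟨fun i => by dsimp; nlinarith [this i], fun i => by dsimp; nlinarith [this i]⟩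
  have hSc : IsCompact S := isCompact_Icc.of_isClosed_subset hScl hSb
  have hSn : S.Nonempty := by
    obtain ⟨w⟩ := ‹Nonempty W›
    exact ⟨Pi.single w 1, by simp [S]⟩
  obtain ⟨x0, hx0, hmax⟩ := hSc.exists_isMaxOn hSn hf.continuousOn
  set r := f x0 with hr
  have hray : ∀ y : W → ℝ, y ⬝ᵥ (D *ᵥ y) ≤ r * (y ⬝ᵥ y) := by
    intro y
    by_cases hy : y = 0
    · simp [hy]
    · have hpos : 0 < y ⬝ᵥ y := by
        have h1 : 0 ≤ y ⬝ᵥ y := Finset.sum_nonneg fun i _ => mul_self_nonneg _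
        exact lt_of_le_of_ne h1 fun h => hy (dotProduct_self_eq_zero.mp h.symm)
      set t := (Real.sqrt (y ⬝ᵥ y))⁻¹ with ht
      have htt : t * t * (y ⬝ᵥ y) = 1 := by
        rw [ht, ← mul_inv, Real.mul_self_sqrt hpos.le]
        exact inv_mul_cancel₀ hpos.ne'
      have h1 : t • y ∈ S := by
        simp only [S, Set.mem_ofPred_eq, smul_dotProduct, dotProduct_smul, smul_eq_mul]
        linarith
      have h2 : f (t • y) ≤ r := hmax h1
      simp only [f, mulVec_smul, smul_dotProduct, dotProduct_smul, smul_eq_mul] at h2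
      have : (y ⬝ᵥ y) * (t * (t * (y ⬝ᵥ (D *ᵥ y)))) ≤ (y ⬝ᵥ y) * r :=
        mul_le_mul_of_nonneg_left h2 hpos.le
      calc y ⬝ᵥ (D *ᵥ y) = (t * t * (y ⬝ᵥ y)) * (y ⬝ᵥ (D *ᵥ y)) := by rw [htt, one_mul]
        _ = (y ⬝ᵥ y) * (t * (t * (y ⬝ᵥ (D *ᵥ y)))) := by ring
        _ ≤ _ := this
        _ = _ := by ring
  let x : W → ℝ := fun i => |x0 i|
  have hx0' : x0 ⬝ᵥ x0 = 1 := hx0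
  have hxx : x ⬝ᵥ x = 1 := by
    rw [← hx0']
    simp [x, dotProduct]
  have hxr : x ⬝ᵥ (D *ᵥ x) = r := by
    apply le_antisymm
    · have := hray x
      rwa [hxx, mul_one] at this
    · rw [hr]
      simp only [f, dotProduct, mulVec, Finset.mul_sum]
      refine Finset.sum_le_sum fun i _ => Finset.sum_le_sum fun j _ => ?_
      calc x0 i * (D i j * x0 j) ≤ |x0 i * (D i j * x0 j)| := le_abs_self _
        _ = _ := by rw [abs_mul, abs_mul, abs_of_nonneg (hD0 i j)]
  have hpsd : (r • (1 : Matrix W W ℝ) - D).PosSemidef := by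
    refine Matrix.PosSemidef.of_dotProduct_mulVec_nonneg ?_ ?_
    · refine Matrix.IsHermitian.sub ?_ hDs
      ext i j
      simp [Matrix.one_apply, eq_comm]
    · intro y
      have := hray y
      simp [sub_mulVec, smul_mulVec, dotProduct_sub]
      linarith
  have heig : D *ᵥ x = r • x := by
    have h := (hpsd.dotProduct_mulVec_zero_iff x).mp (by
      simp [sub_mulVec, smul_mulVec, dotProduct_sub, hxr, hxx])
    simp only [sub_mulVec, smul_mulVec, one_mulVec] at h
    exact (sub_eq_zero.mp h).symm
  have hxne : x ≠ 0 := by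
    intro h
    rw [h] at hxx
    simp at hxx
  have hrho : distSpectralRadius H = r := by
    apply IsGreatest.csSup_eq
    refine ⟨⟨x, hxne, heig⟩, ?_⟩
    rintro μ ⟨y, hy, hμ⟩
    have h1 := hray y
    rw [hD, hμ, dotProduct_smul, smul_eq_mul] at h1
    have hpos : 0 < y ⬝ᵥ y := by
      have h1 : 0 ≤ y ⬝ᵥ y := Finset.sum_nonneg fun i _ => mul_self_nonneg _
      exact lt_of_le_of_ne h1 fun h => hy (dotProduct_self_eq_zero.mp h.symm)
    exact le_of_mul_le_mul_right h1 hpos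
  rw [hrho]
  exact ⟨⟨x, fun v => abs_nonneg _, hxne, heig⟩, hray⟩

/-- The key inequality on the sums along the two arms. -/
theorem aux_arms {V : Type*} [Fintype V] (G : SimpleGraph V) (w : V) (p q : ℕ)
    (hq : 1 ≤ q) (hpq : q ≤ p) (x : V ⊕ (Fin p ⊕ Fin q) → ℝ) (hx : ∀ v, 0 ≤ x v) (r : ℝ)
    (hr : 0 < r)
    (heig : ∀ a, ∑ b, (auxD G w p q a b : ℝ) * x b = r * x a) :
    ∑ j, x (Sum.inr (Sum.inr j)) ≤ ∑ i, x (Sum.inr (Sum.inl i)) := by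
  let A : ℕ → ℝ := fun i => ∑ j : Fin p, if i ≤ (j : ℕ) then x (Sum.inr (Sum.inl j)) else 0
  let B : ℕ → ℝ := fun i => ∑ j : Fin q, if i ≤ (j : ℕ) then x (Sum.inr (Sum.inr j)) else 0
  have hA0 : A 0 = ∑ i, x (Sum.inr (Sum.inl i)) := by simp [A]
  have hB0 : B 0 = ∑ i, x (Sum.inr (Sum.inr i)) := by simp [B]
  let δ : ∀ i, i < q → ℝ := fun i hi =>
    x (Sum.inr (Sum.inl ⟨i, by omega⟩)) - x (Sum.inr (Sum.inr ⟨i, hi⟩))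
  have hA : ∀ i (hi : i < p), A i = A (i + 1) + x (Sum.inr (Sum.inl ⟨i, hi⟩)) := by
    intro i hi
    have : x (Sum.inr (Sum.inl ⟨i, hi⟩)) =
        ∑ j : Fin p, if j = ⟨i, hi⟩ then x (Sum.inr (Sum.inl j)) else 0 := by simp
    rw [this]
    simp only [A]
    rw [← Finset.sum_add_distrib]
    refine Finset.sum_congr rfl fun j _ => ?_
    rcases lt_trichotomy (j : ℕ) i with h | h | h
    · rw [if_neg (by omega), if_neg (by omega), if_neg (by simp [Fin.ext_iff]; omega)]; simp
    · rw [if_pos (by omega), if_neg (by omega), if_pos (by simp [Fin.ext_iff]; omega)]; simp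
    · rw [if_pos (by omega), if_pos (by omega), if_neg (by simp [Fin.ext_iff]; omega)]; simp
  have hB : ∀ i (hi : i < q), B i = B (i + 1) + x (Sum.inr (Sum.inr ⟨i, hi⟩)) := by
    intro i hi
    have : x (Sum.inr (Sum.inr ⟨i, hi⟩)) =
        ∑ j : Fin q, if j = ⟨i, hi⟩ then x (Sum.inr (Sum.inr j)) else 0 := by simp
    rw [this]
    simp only [B]
    rw [← Finset.sum_add_distrib]
    refine Finset.sum_congr rfl fun j _ => ?_
    rcases lt_trichotomy (j : ℕ) i with h | h | h
    · rw [if_neg (by omega), if_neg (by omega), if_neg (by simp [Fin.ext_iff]; omega)]; simp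
    · rw [if_pos (by omega), if_neg (by omega), if_pos (by simp [Fin.ext_iff]; omega)]; simp
    · rw [if_pos (by omega), if_pos (by omega), if_neg (by simp [Fin.ext_iff]; omega)]; simp
  have hδ0 : r * δ 0 hq = 2 * (B 0 - A 0) := by
    simp only [δ]
    rw [mul_sub, ← heig, ← heig, ← Finset.sum_sub_distrib]
    simp only [Fintype.sum_sum_type]
    rw [hA0, hB0, mul_sub, Finset.mul_sum, Finset.mul_sum]
    have e1 : ∀ y : V, (auxD G w p q (Sum.inr (Sum.inl ⟨0, by omega⟩)) (Sum.inl y) : ℝ)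
        - auxD G w p q (Sum.inr (Sum.inr ⟨0, hq⟩)) (Sum.inl y) = 0 := by
      intro y; simp [auxD]
    have e2 : ∀ j : Fin p,
        (auxD G w p q (Sum.inr (Sum.inl ⟨0, by omega⟩)) (Sum.inr (Sum.inl j)) : ℝ)
        - auxD G w p q (Sum.inr (Sum.inr ⟨0, hq⟩)) (Sum.inr (Sum.inl j)) = -2 := by
      intro y; simp [auxD]
    have e3 : ∀ j : Fin q,
        (auxD G w p q (Sum.inr (Sum.inl ⟨0, by omega⟩)) (Sum.inr (Sum.inr j)) : ℝ)
        - auxD G w p q (Sum.inr (Sum.inr ⟨0, hq⟩)) (Sum.inr (Sum.inr j)) = 2 := by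
      intro y; simp [auxD]
    simp only [← sub_mul, e1, e2, e3]
    simp [← Finset.mul_sum]
    ring
  have hδ : ∀ i (hi : i + 1 < q),
      r * (δ (i + 1) hi - δ i (by omega)) = 2 * (B (i + 1) - A (i + 1)) := by
    intro i hi
    simp only [δ]
    rw [mul_sub, mul_sub, mul_sub, ← heig, ← heig, ← heig, ← heig, ← Finset.sum_sub_distrib,
      ← Finset.sum_sub_distrib, ← Finset.sum_sub_distrib]
    simp only [Fintype.sum_sum_type, A, B]
    rw [mul_sub, Finset.mul_sum, Finset.mul_sum]
    simp only [← sub_mul]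
    have e1 : ∀ y : V, ((auxD G w p q (Sum.inr (Sum.inl ⟨i + 1, by omega⟩)) (Sum.inl y) : ℝ)
        - auxD G w p q (Sum.inr (Sum.inr ⟨i + 1, hi⟩)) (Sum.inl y))
        - (auxD G w p q (Sum.inr (Sum.inl ⟨i, by omega⟩)) (Sum.inl y)
        - auxD G w p q (Sum.inr (Sum.inr ⟨i, by omega⟩)) (Sum.inl y)) = 0 := by
      intro y; simp [auxD]
    have e2 : ∀ j : Fin p,
        ((auxD G w p q (Sum.inr (Sum.inl ⟨i + 1, by omega⟩)) (Sum.inr (Sum.inl j)) : ℝ)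
        - auxD G w p q (Sum.inr (Sum.inr ⟨i + 1, hi⟩)) (Sum.inr (Sum.inl j)))
        - (auxD G w p q (Sum.inr (Sum.inl ⟨i, by omega⟩)) (Sum.inr (Sum.inl j))
        - auxD G w p q (Sum.inr (Sum.inr ⟨i, by omega⟩)) (Sum.inr (Sum.inl j)))
        = if i + 1 ≤ (j : ℕ) then -2 else 0 := by
      intro j
      have : ((auxD G w p q (Sum.inr (Sum.inl ⟨i + 1, by omega⟩)) (Sum.inr (Sum.inl j)) : ℤ)
        - auxD G w p q (Sum.inr (Sum.inr ⟨i + 1, hi⟩)) (Sum.inr (Sum.inl j)))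
        - (auxD G w p q (Sum.inr (Sum.inl ⟨i, by omega⟩)) (Sum.inr (Sum.inl j))
        - auxD G w p q (Sum.inr (Sum.inr ⟨i, by omega⟩)) (Sum.inr (Sum.inl j)))
        = if i + 1 ≤ (j : ℕ) then -2 else 0 := by
        simp only [auxD]
        split_ifs <;> omega
      exact_mod_cast this
    have e3 : ∀ j : Fin q,
        ((auxD G w p q (Sum.inr (Sum.inl ⟨i + 1, by omega⟩)) (Sum.inr (Sum.inr j)) : ℝ)
        - auxD G w p q (Sum.inr (Sum.inr ⟨i + 1, hi⟩)) (Sum.inr (Sum.inr j)))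
        - (auxD G w p q (Sum.inr (Sum.inl ⟨i, by omega⟩)) (Sum.inr (Sum.inr j))
        - auxD G w p q (Sum.inr (Sum.inr ⟨i, by omega⟩)) (Sum.inr (Sum.inr j)))
        = if i + 1 ≤ (j : ℕ) then 2 else 0 := by
      intro j
      have : ((auxD G w p q (Sum.inr (Sum.inl ⟨i + 1, by omega⟩)) (Sum.inr (Sum.inr j)) : ℤ)
        - auxD G w p q (Sum.inr (Sum.inr ⟨i + 1, hi⟩)) (Sum.inr (Sum.inr j)))
        - (auxD G w p q (Sum.inr (Sum.inl ⟨i, by omega⟩)) (Sum.inr (Sum.inr j))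
        - auxD G w p q (Sum.inr (Sum.inr ⟨i, by omega⟩)) (Sum.inr (Sum.inr j)))
        = if i + 1 ≤ (j : ℕ) then 2 else 0 := by
        simp only [auxD]
        split_ifs <;> omega
      exact_mod_cast this
    simp only [e1, e2, e3, zero_mul, Finset.sum_const_zero, zero_add]
    rw [add_comm, sub_eq_add_neg, ← Finset.sum_neg_distrib]
    congr 1
    · refine Finset.sum_congr rfl fun j _ => ?_
      split_ifs <;> simp
    · refine Finset.sum_congr rfl fun j _ => ?_
      split_ifs <;> simp
  rw [← hA0, ← hB0]
  by_contra! hcon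
  have key : ∀ i (hi : i < q), 0 < B i - A i ∧ 0 < δ i hi := by
    intro i
    induction i with
    | zero =>
      intro hi
      refine ⟨by linarith, ?_⟩
      have : 0 < r * δ 0 hq := by rw [hδ0]; linarith
      exact (mul_pos_iff_of_pos_left hr).mp this
    | succ i ih =>
      intro hi
      obtain ⟨h1, h2⟩ := ih (by omega)
      have h3 := hA i (by omega)
      have h4 := hB i (by omega)
      have h5 : δ i (by omega) = x (Sum.inr (Sum.inl ⟨i, by omega⟩))
        - x (Sum.inr (Sum.inr ⟨i, by omega⟩)) := rfl
      have h6 : 0 < B (i + 1) - A (i + 1) := by linarith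
      have h7 : 0 < r * (δ (i + 1) hi - δ i (by omega)) := by rw [hδ i hi]; linarith
      have h8 := (mul_pos_iff_of_pos_left hr).mp h7
      exact ⟨h6, by linarith⟩
  obtain ⟨h1, h2⟩ := key (q - 1) (by omega)
  have h3 := hA (q - 1) (by omega)
  have h4 := hB (q - 1) (by omega)
  have h5 : δ (q - 1) (by omega) = x (Sum.inr (Sum.inl ⟨q - 1, by omega⟩))
        - x (Sum.inr (Sum.inr ⟨q - 1, by omega⟩)) := rfl
  have h6 : 0 ≤ A (q - 1 + 1) := Finset.sum_nonneg fun j _ => by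
    split_ifs
    · exact hx _
    · exact le_rfl
  have h7 : B (q - 1 + 1) = 0 := Finset.sum_eq_zero fun j _ => by
    rw [if_neg (by omega)]
  linarith

open Classical in
/-- Vertex identification sliding `G - w` by one along the path. -/
noncomputable def auxPhi {V : Type*} (w : V) (p k : ℕ) :
    V ⊕ (Fin p ⊕ Fin (k + 1)) → V ⊕ (Fin (p + 1) ⊕ Fin k)
  | Sum.inl x => if x = w then Sum.inr (Sum.inl 0) else Sum.inl x
  | Sum.inr (Sum.inl i) => Sum.inr (Sum.inl i.succ)
  | Sum.inr (Sum.inr i) =>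
    if h : (i : ℕ) = 0 then Sum.inl w else Sum.inr (Sum.inr ⟨i - 1, by omega⟩)

theorem auxPhi_bij {V : Type*} [Fintype V] (w : V) (p k : ℕ) :
    Function.Bijective (auxPhi w p k) := by
  classical
  rw [Fintype.bijective_iff_injective_and_card]
  constructor
  · rintro (x | i | i) (y | j | j) h <;> simp only [auxPhi] at h <;> (try split_ifs at h) <;>
      simp only [Sum.inl.injEq, Sum.inr.injEq, Fin.ext_iff, reduceCtorEq, Fin.val_succ,
        Fin.val_zero] at h ⊢ <;>
      grind
  · simp; omega

open Classical in
/-- Indicator of `G - w`. -/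
noncomputable def auxC {V : Type*} (w : V) (p q : ℕ) : V ⊕ (Fin p ⊕ Fin q) → ℤ
  | Sum.inl x => if x = w then 0 else 1
  | Sum.inr _ => 0

open Classical in
/-- Signed indicator of the two sides of the path. -/
noncomputable def auxS {V : Type*} (w : V) (p q : ℕ) : V ⊕ (Fin p ⊕ Fin q) → ℤ
  | Sum.inl x => if x = w then 1 else 0
  | Sum.inr (Sum.inl _) => 1
  | Sum.inr (Sum.inr _) => -1

theorem aux_diff {V : Type*} (G : SimpleGraph V) (w : V) (p k : ℕ)
    (a b : V ⊕ (Fin p ⊕ Fin (k + 1))) :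
    (auxD G w (p + 1) k (auxPhi w p k a) (auxPhi w p k b) : ℤ) =
      auxD G w p (k + 1) a b + (auxC w p (k + 1) a * auxS w p (k + 1) b
        + auxS w p (k + 1) a * auxC w p (k + 1) b) := by
  have hw0 : G.dist w w = 0 := SimpleGraph.dist_self
  have hc : ∀ u v, G.dist u v = G.dist v u := fun u v => SimpleGraph.dist_comm
  rcases a with (x | i | i) <;> rcases b with (y | j | j) <;>
    simp only [auxPhi, auxC, auxS] <;> (try split_ifs) <;>
    simp only [auxD, Fin.val_succ, Fin.val_zero] <;>
    first
      | omega
      | grind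

open Matrix in
theorem aux_main {V : Type*} [Fintype V] (G : SimpleGraph V) (hG : G.Connected)
    (hV : Nontrivial V) (w : V) (p k : ℕ) (hpq : k + 1 ≤ p) :
    distSpectralRadius (attachPaths G w p (k + 1)) <
      distSpectralRadius (attachPaths G w (p + 1) k) := by
  classical
  have : Nonempty V := ⟨w⟩
  obtain ⟨⟨x, hx0, hxne, heig⟩, hray1⟩ := aux_perron (attachPaths G w p (k + 1))
  obtain ⟨-, hray2⟩ := aux_perron (attachPaths G w (p + 1) k)
  set r := distSpectralRadius (attachPaths G w p (k + 1)) with hr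
  set r' := distSpectralRadius (attachPaths G w (p + 1) k) with hr'
  have heig' : ∀ a, ∑ b, (auxD G w p (k + 1) a b : ℝ) * x b = r * x a := by
    intro a
    have := congrFun heig a
    simpa [mulVec, dotProduct, distMatrix, aux_dist G hG] using this
  have hDpos : ∀ a b, a ≠ b → 0 < (auxD G w p (k + 1) a b : ℝ) := by
    intro a b hab
    rw [Nat.cast_pos, ← aux_dist G hG]
    rw [Nat.pos_iff_ne_zero]
    intro h0
    have hst : auxD G w p (k + 1) a b = 0 := by rw [← aux_dist G hG]; exact h0
    rcases a with (x | i | i) <;> rcases b with (y | j | j) <;> simp only [auxD] at hst <;>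
      first
        | omega
        | (apply hab; congr 1; exact (hG.dist_eq_zero_iff).mp hst)
        | (apply hab; congr 2; apply Fin.ext; omega)
  obtain ⟨c, hc⟩ : ∃ c, 0 < x c := by
    by_contra! h
    exact hxne (funext fun v => le_antisymm (h v) (hx0 v))
  have hoff : ∀ a, a ≠ c → 0 < r * x a := by
    intro a ha
    rw [← heig']
    exact Finset.sum_pos' (fun b _ => mul_nonneg (Nat.cast_nonneg _) (hx0 b))
      ⟨c, Finset.mem_univ _, mul_pos (hDpos a c ha) hc⟩
  have : Nontrivial (V ⊕ (Fin p ⊕ Fin (k + 1))) :=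
    ⟨⟨Sum.inl w, Sum.inr (Sum.inr 0), by simp⟩⟩
  obtain ⟨a0, ha0⟩ := exists_ne c
  have hrpos : 0 < r := by
    have := hoff a0 ha0
    by_contra! h
    nlinarith [hx0 a0]
  have hxpos : ∀ a, 0 < x a := by
    intro a
    by_cases ha : a = c
    · rwa [ha]
    · exact (mul_pos_iff_of_pos_left hrpos).mp (hoff a ha)
  have harms := aux_arms G w p (k + 1) (by omega) hpq x hx0 r hrpos heig'
  let e := Equiv.ofBijective _ (auxPhi_bij w p k)
  have hee : ∀ a, e a = auxPhi w p k a := fun a => rfl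
  let y : V ⊕ (Fin (p + 1) ⊕ Fin k) → ℝ := fun a => x (e.symm a)
  have hyy : y ⬝ᵥ y = x ⬝ᵥ x := by
    simp only [dotProduct, y]
    exact Equiv.sum_comp e.symm fun a => x a * x a
  have h2 := hray2 y
  have hC : 0 < ∑ a, (auxC w p (k + 1) a : ℝ) * x a := by
    obtain ⟨g, hg⟩ := exists_ne w
    refine Finset.sum_pos' (fun b _ => mul_nonneg ?_ (hx0 b))
      ⟨Sum.inl g, Finset.mem_univ _, ?_⟩
    · rcases b with b | b
      · simp only [auxC]; split_ifs <;> simp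
      · simp [auxC]
    · simp [auxC, hg, hxpos]
  have hS : 0 < ∑ a, (auxS w p (k + 1) a : ℝ) * x a := by
    have hw : ∑ v : V, (auxS w p (k + 1) (Sum.inl v) : ℝ) * x (Sum.inl v) = x (Sum.inl w) := by
      simp [auxS]
    simp only [Fintype.sum_sum_type, hw]
    simp only [auxS]
    have := hxpos (Sum.inl w)
    simp
    linarith
  have hquad : y ⬝ᵥ (distMatrix (attachPaths G w (p + 1) k) *ᵥ y) =
      r * (x ⬝ᵥ x) + 2 * ((∑ a, (auxC w p (k + 1) a : ℝ) * x a) *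
        ∑ a, (auxS w p (k + 1) a : ℝ) * x a) := by
    have h1 : y ⬝ᵥ (distMatrix (attachPaths G w (p + 1) k) *ᵥ y) =
        ∑ a, ∑ b, x a * ((auxD G w (p + 1) k (auxPhi w p k a) (auxPhi w p k b) : ℝ) * x b) := by
      simp only [dotProduct, mulVec, distMatrix, aux_dist G hG]
      rw [← Equiv.sum_comp e]
      refine Finset.sum_congr rfl fun a _ => ?_
      rw [← Equiv.sum_comp e, Finset.mul_sum]
      refine Finset.sum_congr rfl fun b _ => ?_
      simp only [y, Equiv.symm_apply_apply]
      rfl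
    have h3 : ∀ a b, (auxD G w (p + 1) k (auxPhi w p k a) (auxPhi w p k b) : ℝ) =
        auxD G w p (k + 1) a b + (auxC w p (k + 1) a * auxS w p (k + 1) b
        + auxS w p (k + 1) a * auxC w p (k + 1) b) := fun a b => by
      exact_mod_cast aux_diff G w p k a b
    have h4 : r * (x ⬝ᵥ x) = ∑ a, ∑ b, x a * ((auxD G w p (k + 1) a b : ℝ) * x b) := by
      simp only [← Finset.mul_sum, heig', dotProduct]
      rw [Finset.mul_sum]
      exact Finset.sum_congr rfl fun a _ => by ring
    rw [h1, h4, two_mul]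
    nth_rewrite 2 [mul_comm (∑ a, (auxC w p (k + 1) a : ℝ) * x a)]
    rw [Finset.sum_mul_sum, Finset.sum_mul_sum]
    simp only [← Finset.sum_add_distrib, h3]
    exact Finset.sum_congr rfl fun a _ => Finset.sum_congr rfl fun b _ => by ring
  rw [hquad, hyy] at h2
  have hxx : 0 < x ⬝ᵥ x := Finset.sum_pos (fun a _ => mul_pos (hxpos a) (hxpos a))
    ⟨c, Finset.mem_univ _⟩
  have := mul_pos hC hS
  exact lt_of_mul_lt_mul_right (by linarith) hxx.le

end Aux

/-- Lemma 2.1: if `p ≥ q ≥ 1`, then moving one vertex from the shorter pendant path at `w`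
to the longer one strictly increases the distance spectral radius. -/
theorem stmt1 {V : Type*} [Fintype V] (G : SimpleGraph V) (hG : G.Connected)
    (hV : Nontrivial V) (w : V) (p q : ℕ) (hq : 1 ≤ q) (hpq : q ≤ p) :
    distSpectralRadius (attachPaths G w (p + 1) (q - 1)) >
      distSpectralRadius (attachPaths G w p q) := by
  obtain ⟨k, rfl⟩ : ∃ k, q = k + 1 := ⟨q - 1, by omega⟩
  exact aux_main G hG hV w p k hpq
end

section
/- Let T_1 be the tree obtained from a path v_k ⋯ v_1 u_1 ⋯ u_k (k ≥ 2) by attaching n − 2k ≥ 1 pendant vertices to v_1, and let X be its distance Perron vector. Then x_{v_1} + ⌈(n−2k)/2⌉ · x_{v_n} > x_{u_k}, where v_n is any of the attached pendant vertices and u_k is the far endpoint of the longer arm. -/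
open SimpleGraph

/-- The tree `T₁`: the path `v_k ⋯ v_1 u_1 ⋯ u_k` on `2k` vertices together with `m`
pendant vertices attached at `v_1`.  Here `Sum.inl i` is `v_{i+1}`, `Sum.inr (Sum.inl i)`
is `u_{i+1}`, and `Sum.inr (Sum.inr j)` are the pendant vertices. -/
def treeT1 (k m : ℕ) : SimpleGraph (Fin k ⊕ (Fin k ⊕ Fin m)) :=
  SimpleGraph.fromRel (fun a b =>
    match a, b with
    | Sum.inl i, Sum.inl j => (i : ℕ) + 1 = (j : ℕ)
    | Sum.inr (Sum.inl i), Sum.inr (Sum.inl j) => (i : ℕ) + 1 = (j : ℕ)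
    | Sum.inl i, Sum.inr (Sum.inl j) => (i : ℕ) = 0 ∧ (j : ℕ) = 0
    | Sum.inl i, Sum.inr (Sum.inr _) => (i : ℕ) = 0
    | _, _ => False)


theorem dist_eq_of_local {V : Type*} (G : SimpleGraph V) (d : V → V → ℕ)
    (h0 : ∀ x, d x x = 0)
    (hl : ∀ x y z, G.Adj y z → d x z ≤ d x y + 1)
    (hd : ∀ x y, x ≠ y → ∃ z, G.Adj z y ∧ d x y = d x z + 1) (x y : V) :
    G.dist x y = d x y := by
  have hw : ∀ n y, d x y = n → ∃ p : G.Walk x y, p.length = n := by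
    intro n
    induction n with
    | zero =>
      intro y hy
      by_cases hxy : x = y
      · subst hxy; exact ⟨Walk.nil, rfl⟩
      · obtain ⟨z, _, h⟩ := hd x y hxy
        omega
    | succ n ih =>
      intro y hy
      by_cases hxy : x = y
      · subst hxy; rw [h0] at hy; omega
      · obtain ⟨z, hz, h⟩ := hd x y hxy
        obtain ⟨p, hp⟩ := ih z (by omega)
        exact ⟨p.concat hz, by simp [hp]⟩
  have hlow : ∀ (u v : V) (p : G.Walk u v), d x v ≤ d x u + p.length := by
    intro u v p
    induction p with
    | nil => simp
    | cons h p ih =>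
      have := hl x _ _ h
      simp only [Walk.length_cons]
      omega
  obtain ⟨p, hp⟩ := hw _ y rfl
  apply le_antisymm
  · rw [← hp]; exact dist_le p
  · obtain ⟨q, hq⟩ := p.reachable.exists_walk_length_eq_dist
    have := hlow x y q
    rw [h0] at this
    omega

/-- explicit distance -/
def dT (k m : ℕ) : (Fin k ⊕ (Fin k ⊕ Fin m)) → (Fin k ⊕ (Fin k ⊕ Fin m)) → ℕ
  | Sum.inl i, Sum.inl j => ((i : ℕ) - j) + (j - i)
  | Sum.inl i, Sum.inr (Sum.inl j) => (i : ℕ) + j + 1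
  | Sum.inl i, Sum.inr (Sum.inr _) => (i : ℕ) + 1
  | Sum.inr (Sum.inl i), Sum.inl j => (i : ℕ) + j + 1
  | Sum.inr (Sum.inl i), Sum.inr (Sum.inl j) => ((i : ℕ) - j) + (j - i)
  | Sum.inr (Sum.inl i), Sum.inr (Sum.inr _) => (i : ℕ) + 2
  | Sum.inr (Sum.inr _), Sum.inl j => (j : ℕ) + 1
  | Sum.inr (Sum.inr _), Sum.inr (Sum.inl j) => (j : ℕ) + 2
  | Sum.inr (Sum.inr p), Sum.inr (Sum.inr q) => if p = q then 0 else 2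

theorem dist_treeT1 (k m : ℕ) (hk : 2 ≤ k) (x y) : (treeT1 k m).dist x y = dT k m x y := by
  apply dist_eq_of_local
  · rintro (i | i | i) <;> simp [dT]
  · rintro (x | x | x) (y | y | y) (z | z | z) h <;>
      simp [treeT1, dT] at h ⊢ <;> (try split_ifs) <;> omega
  · have step : ∀ i j : Fin k, i ≠ j → ∃ l : Fin k,
        ((l : ℕ) + 1 = j ∨ (j : ℕ) + 1 = l) ∧
        ((i : ℕ) - j) + (j - i) = ((i : ℕ) - l) + (l - i) + 1 := by
      intro i j hij
      have : (i : ℕ) ≠ j := fun h => hij (Fin.ext h)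
      by_cases h : (i : ℕ) < j
      · exact ⟨⟨j - 1, by omega⟩, by simp; omega, by simp; omega⟩
      · exact ⟨⟨j + 1, by omega⟩, by simp, by simp; omega⟩
    rintro (x | x | x) (y | y | y) h
    · obtain ⟨l, h1, h2⟩ := step x y (by simpa using h)
      refine ⟨Sum.inl l, ?_, by simpa [dT] using h2⟩
      simp [treeT1, Fin.ext_iff]; omega
    · by_cases hy : (y : ℕ) = 0
      · exact ⟨Sum.inl ⟨0, by omega⟩, by simp [treeT1, hy], by simp [dT, hy]⟩
      · exact ⟨Sum.inr (Sum.inl ⟨y - 1, by omega⟩), by simp [treeT1, Fin.ext_iff]; omega,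
          by simp [dT]; omega⟩
    · exact ⟨Sum.inl ⟨0, by omega⟩, by simp [treeT1], by simp [dT]⟩
    · by_cases hy : (y : ℕ) = 0
      · exact ⟨Sum.inr (Sum.inl ⟨0, by omega⟩), by simp [treeT1, hy], by simp [dT, hy]⟩
      · exact ⟨Sum.inl ⟨y - 1, by omega⟩, by simp [treeT1, Fin.ext_iff]; omega,
          by simp [dT]; omega⟩
    · obtain ⟨l, h1, h2⟩ := step x y (by simpa using h)
      refine ⟨Sum.inr (Sum.inl l), ?_, by simpa [dT] using h2⟩
      simp [treeT1, Fin.ext_iff]; omega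
    · exact ⟨Sum.inl ⟨0, by omega⟩, by simp [treeT1], by simp [dT]⟩
    · by_cases hy : (y : ℕ) = 0
      · refine ⟨Sum.inr (Sum.inr x), ?_, by simp [dT, hy]⟩
        simp [treeT1, hy]
      · exact ⟨Sum.inl ⟨y - 1, by omega⟩, by simp [treeT1, Fin.ext_iff]; omega,
          by simp [dT]; omega⟩
    · by_cases hy : (y : ℕ) = 0
      · exact ⟨Sum.inl ⟨0, by omega⟩, by simp [treeT1, hy], by simp [dT, hy]⟩
      · exact ⟨Sum.inr (Sum.inl ⟨y - 1, by omega⟩), by simp [treeT1, Fin.ext_iff]; omega,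
          by simp [dT]; omega⟩
    · have : x ≠ y := by simpa using h
      exact ⟨Sum.inl ⟨0, by omega⟩, by simp [treeT1], by simp [dT, this]⟩

theorem cheb (f : ℕ → ℝ) (k : ℕ) (hf : ∀ i, i + 1 < k → f i ≤ f (i + 1)) :
    0 ≤ ∑ i ∈ Finset.range k, (2 * (i : ℝ) - ((k : ℝ) - 1)) * f i := by
  induction k with
  | zero => simp
  | succ k ih =>
    have ih := ih (fun i hi => hf i (by omega))
    have hle : ∀ t i, i + t = k → f i ≤ f k := by
      intro t
      induction t with
      | zero => intro i hi; simp at hi; rw [hi]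
      | succ t iht => intro i hi; exact (hf i (by omega)).trans (iht (i + 1) (by omega))
    have h2 : ∑ i ∈ Finset.range k, f i ≤ ∑ i ∈ Finset.range k, f k :=
      Finset.sum_le_sum fun i hi => hle (k - i) i (by have := Finset.mem_range.1 hi; omega)
    simp only [Finset.sum_const, Finset.card_range, nsmul_eq_mul] at h2
    rw [Finset.sum_range_succ]
    have h3 : ∑ i ∈ Finset.range k, (2 * (i : ℝ) - (((k + 1 : ℕ) : ℝ) - 1)) * f i
        = ∑ i ∈ Finset.range k, (2 * (i : ℝ) - ((k : ℝ) - 1)) * f i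
          - ∑ i ∈ Finset.range k, f i := by
      rw [← Finset.sum_sub_distrib]
      apply Finset.sum_congr rfl
      intro i _
      push_cast; ring
    rw [h3]; push_cast; nlinarith

/-- tail sign propagation -/
theorem tail_nonneg (r : ℝ) (hr : 0 < r) (d : ℕ → ℝ) (k : ℕ)
    (h : ∀ i, i + 1 < k → r * (d i - d (i + 1)) =
      ∑ j ∈ Finset.range k, (if j ≤ i then 0 else 2 * d j))
    (hd : ∀ i, i + 1 = k → 0 ≤ d i) : ∀ i, i < k → 0 ≤ d i := by
  have key : ∀ t i, i < k → k - 1 - i ≤ t → 0 ≤ d i := by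
    intro t
    induction t with
    | zero => intro i hi ht; exact hd i (by omega)
    | succ t ih =>
      intro i hi ht
      by_cases hik : i + 1 < k
      · have h1 := ih (i + 1) hik (by omega)
        have h2 := h i hik
        have h3 : 0 ≤ ∑ j ∈ Finset.range k, (if j ≤ i then 0 else 2 * d j) := by
          apply Finset.sum_nonneg
          intro j hj
          have := Finset.mem_range.1 hj
          split_ifs with hji
          · exact le_rfl
          · have := ih j this (by omega)
            linarith
        rw [← h2] at h3
        have := nonneg_of_mul_nonneg_right h3 hr
        linarith
      · exact hd i (by omega)
  exact fun i hi => key _ i hi le_rfl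

theorem absdiff (i j : ℕ) : (((i + 1 - j + (j - (i + 1)) : ℕ)) : ℝ) =
    ((i - j + (j - i) : ℕ) : ℝ) + (if j ≤ i then 1 else -1) := by
  split_ifs with h
  · have : i + 1 - j + (j - (i + 1)) = (i - j + (j - i)) + 1 := by omega
    rw [this]; push_cast; ring
  · have : i - j + (j - i) = (i + 1 - j + (j - (i + 1))) + 1 := by omega
    rw [this]; push_cast; ring

theorem final_ineq (k c m : ℝ) (A p a0 : ℝ) (hk : 2 ≤ k) (hc : 2 ≤ c) (hm : m = 2 * c ∨ m = 2 * c - 1)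
    (hp : 0 < p) (hA : k * p / 2 ≤ A) :
    0 < (c * (k + 2) - k + 1) * A + c * (2 * m - 2) * p - k * m * p := by
  have h0 : 0 ≤ c * (k + 2) - k + 1 := by nlinarith
  have h1 := mul_le_mul_of_nonneg_left hA h0
  have h2 : 0 < (c * (k + 2) - k + 1) * (k / 2) + c * (2 * m - 2) - k * m := by
    rcases hm with rfl | rfl
    · have : 0 < (c - 1) * k ^ 2 - (2 * c - 1) * k + 8 * c ^ 2 - 4 * c := by
        obtain ⟨e, rfl⟩ : ∃ e, c = e + 2 := ⟨c - 2, by ring⟩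
        have he : 0 ≤ e := by linarith
        nlinarith [mul_nonneg he (sq_nonneg (k - 1)), sq_nonneg (k - 3 / 2), mul_nonneg he he]
      nlinarith
    · have : 0 < (c - 1) * k ^ 2 - (2 * c - 3) * k + 8 * c ^ 2 - 8 * c := by
        obtain ⟨e, rfl⟩ : ∃ e, c = e + 2 := ⟨c - 2, by ring⟩
        have he : 0 ≤ e := by linarith
        nlinarith [mul_nonneg he (sq_nonneg (k - 1)), sq_nonneg (k - 3 / 2), mul_nonneg he he]
      nlinarith
  have h3 := mul_pos h2 hp
  nlinarith

set_option maxHeartbeats 2000000 in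
theorem core (k m : ℕ) (hk : 2 ≤ k) (hm : 1 ≤ m) (r p P : ℝ) (a b : ℕ → ℝ)
    (ha : ∀ i, i < k → 0 < a i) (hb : ∀ i, i < k → 0 < b i) (hp : 0 < p) (hP : P = m * p)
    (hv : ∀ i, i < k → r * a i = ∑ j ∈ Finset.range k, ((i - j + (j - i) : ℕ) : ℝ) * a j
      + ∑ j ∈ Finset.range k, ((i : ℝ) + j + 1) * b j + ((i : ℝ) + 1) * P)
    (hu : ∀ i, i < k → r * b i = ∑ j ∈ Finset.range k, ((i : ℝ) + j + 1) * a j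
      + ∑ j ∈ Finset.range k, ((i - j + (j - i) : ℕ) : ℝ) * b j + ((i : ℝ) + 2) * P)
    (hq : (r + 2) * p = ∑ j ∈ Finset.range k, ((j : ℝ) + 1) * a j
      + ∑ j ∈ Finset.range k, ((j : ℝ) + 2) * b j + 2 * P) :
    b (k - 1) < a 0 + (((m + 1) / 2 : ℕ) : ℝ) * p := by
  have hmR : (1 : ℝ) ≤ m := by exact_mod_cast hm
  have hkR : (2 : ℝ) ≤ k := by exact_mod_cast hk
  have hPpos : 0 < P := by rw [hP]; positivity
  have hkn : (Finset.range k).Nonempty := ⟨0, by simp; omega⟩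
  set A := ∑ j ∈ Finset.range k, a j with hA
  set B := ∑ j ∈ Finset.range k, b j with hB
  set A1 := ∑ j ∈ Finset.range k, (j : ℝ) * a j with hA1
  set B1 := ∑ j ∈ Finset.range k, (j : ℝ) * b j with hB1
  have hApos : 0 < A := Finset.sum_pos (fun i hi => ha i (Finset.mem_range.1 hi)) hkn
  have hBpos : 0 < B := Finset.sum_pos (fun i hi => hb i (Finset.mem_range.1 hi)) hkn
  have hlin : ∀ (f : ℕ → ℝ) (c e : ℝ), ∑ j ∈ Finset.range k, (c * j + e) * f j =
      c * ∑ j ∈ Finset.range k, (j : ℝ) * f j + e * ∑ j ∈ Finset.range k, f j := by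
    intro f c e
    rw [Finset.mul_sum, Finset.mul_sum, ← Finset.sum_add_distrib]
    apply Finset.sum_congr rfl; intros; ring
  -- a 0 equation
  have hv0 : r * a 0 = A1 + (B1 + B) + P := by
    have := hv 0 (by omega)
    have e1 : ∑ j ∈ Finset.range k, ((0 - j + (j - 0) : ℕ) : ℝ) * a j = A1 := by
      apply Finset.sum_congr rfl; intro j _; congr 2; omega
    have e2 := hlin b 1 1
    have e3 : ∑ j ∈ Finset.range k, (((0 : ℕ) : ℝ) + j + 1) * b j = B1 + B := by
      rw [hB1, hB, ← Finset.sum_add_distrib]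
      apply Finset.sum_congr rfl; intros; push_cast; ring
    rw [e1, e3] at this
    rw [this]; push_cast; ring
  have hA1n : 0 ≤ A1 := Finset.sum_nonneg fun i hi =>
    mul_nonneg (Nat.cast_nonneg _) (ha i (Finset.mem_range.1 hi)).le
  have hB1n : 0 ≤ B1 := Finset.sum_nonneg fun i hi =>
    mul_nonneg (Nat.cast_nonneg _) (hb i (Finset.mem_range.1 hi)).le
  have ha0 := ha 0 (by omega)
  have hr : 0 < r := by
    have : 0 < r * a 0 := by rw [hv0]; positivity
    exact pos_of_mul_pos_left this ha0.le
  have hqq : (r + 2) * p = A1 + A + (B1 + 2 * B) + 2 * P := by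
    have e1 := hlin a 1 1
    have e2 := hlin b 1 2
    simp only [one_mul] at e1 e2
    rw [e1, e2] at hq
    exact hq
  -- last
  have hlast : r * b (k - 1) = A1 + k * A + ((k - 1) * B - B1) + (k + 1) * P := by
    have := hu (k - 1) (by omega)
    have hc : ((k - 1 : ℕ) : ℝ) = (k : ℝ) - 1 := by rw [Nat.cast_sub (by omega)]; simp
    have e1 := hlin a 1 k
    have e2 := hlin b (-1) (k - 1)
    have e3 : ∑ j ∈ Finset.range k, (((k - 1 : ℕ) : ℝ) + j + 1) * a j = A1 + k * A := by
      rw [hA1, hA]; simp only [one_mul] at e1; rw [← e1]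
      apply Finset.sum_congr rfl; intros; rw [hc]; ring
    have e4 : ∑ j ∈ Finset.range k, ((k - 1 - j + (j - (k - 1)) : ℕ) : ℝ) * b j
        = (k - 1) * B - B1 := by
      rw [show (k - 1) * B - B1 = -1 * B1 + (k - 1) * B by ring, hB1, hB, ← e2]
      apply Finset.sum_congr rfl
      intro j hj
      have hj := Finset.mem_range.1 hj
      have : k - 1 - j + (j - (k - 1)) = k - 1 - j := by omega
      rw [this, Nat.cast_sub (by omega), hc]; ring
    rw [e3, e4, hc] at this
    rw [this]; ring
  -- differences
  have hda : ∀ i, i + 1 < k → r * (a (i + 1) - a i) =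
      ∑ j ∈ Finset.range k, (if j ≤ i then 1 else -1) * a j + B + P := by
    intro i hi
    rw [mul_sub, hv _ hi, hv i (by omega)]
    have e1 : ∑ j ∈ Finset.range k, ((i + 1 - j + (j - (i + 1)) : ℕ) : ℝ) * a j =
        ∑ j ∈ Finset.range k, ((i - j + (j - i) : ℕ) : ℝ) * a j +
        ∑ j ∈ Finset.range k, (if j ≤ i then 1 else -1) * a j := by
      rw [← Finset.sum_add_distrib]
      apply Finset.sum_congr rfl; intro j _; rw [absdiff]; ring
    have e2 : ∑ j ∈ Finset.range k, (((i + 1 : ℕ) : ℝ) + j + 1) * b j =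
        ∑ j ∈ Finset.range k, ((i : ℝ) + j + 1) * b j + B := by
      rw [hB, ← Finset.sum_add_distrib]
      apply Finset.sum_congr rfl; intro j _; push_cast; ring
    rw [e1, e2]; push_cast; ring
  have hdb : ∀ i, i + 1 < k → r * (b (i + 1) - b i) =
      ∑ j ∈ Finset.range k, (if j ≤ i then 1 else -1) * b j + A + P := by
    intro i hi
    rw [mul_sub, hu _ hi, hu i (by omega)]
    have e1 : ∑ j ∈ Finset.range k, ((i + 1 - j + (j - (i + 1)) : ℕ) : ℝ) * b j =
        ∑ j ∈ Finset.range k, ((i - j + (j - i) : ℕ) : ℝ) * b j +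
        ∑ j ∈ Finset.range k, (if j ≤ i then 1 else -1) * b j := by
      rw [← Finset.sum_add_distrib]
      apply Finset.sum_congr rfl; intro j _; rw [absdiff]; ring
    have e2 : ∑ j ∈ Finset.range k, (((i + 1 : ℕ) : ℝ) + j + 1) * a j =
        ∑ j ∈ Finset.range k, ((i : ℝ) + j + 1) * a j + A := by
      rw [hA, ← Finset.sum_add_distrib]
      apply Finset.sum_congr rfl; intro j _; push_cast; ring
    rw [e1, e2]; push_cast; ring
  have hu0 : r * b 0 = A1 + A + B1 + 2 * P := by
    have := hu 0 (by omega)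
    have e1 : ∑ j ∈ Finset.range k, ((0 - j + (j - 0) : ℕ) : ℝ) * b j = B1 := by
      apply Finset.sum_congr rfl; intro j _; congr 2; omega
    have e3 : ∑ j ∈ Finset.range k, (((0 : ℕ) : ℝ) + j + 1) * a j = A1 + A := by
      rw [hA1, hA, ← Finset.sum_add_distrib]
      apply Finset.sum_congr rfl; intros; push_cast; ring
    rw [e1, e3] at this
    rw [this]; push_cast; ring
  have hd0 : r * (b 0 - a 0) = P - (B - A) := by rw [mul_sub, hu0, hv0]; ring
  have hdd : ∀ i, i + 1 < k → r * ((b i - a i) - (b (i + 1) - a (i + 1))) =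
      ∑ j ∈ Finset.range k, (if j ≤ i then 0 else 2 * (b j - a j)) := by
    intro i hi
    have h1 := hda i hi
    have h2 := hdb i hi
    have : r * ((b i - a i) - (b (i + 1) - a (i + 1))) =
      r * (a (i + 1) - a i) - r * (b (i + 1) - b i) := by ring
    rw [this, h1, h2]
    have : ∑ j ∈ Finset.range k, (if j ≤ i then 0 else 2 * (b j - a j)) =
      ∑ j ∈ Finset.range k, (if j ≤ i then 1 else -1) * a j + B
       - (∑ j ∈ Finset.range k, (if j ≤ i then 1 else -1) * b j + A) := by
      rw [hB, hA, ← Finset.sum_add_distrib, ← Finset.sum_add_distrib, ← Finset.sum_sub_distrib]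
      apply Finset.sum_congr rfl; intro j _; split_ifs <;> ring
    rw [this]; ring
  have hlastd : 0 ≤ b (k - 1) - a (k - 1) := by
    by_contra hneg
    push Not at hneg
    have hall := tail_nonneg r hr (fun i => a i - b i) k (by
      intro i hi
      have := hdd i hi
      have e : r * ((a i - b i) - (a (i + 1) - b (i + 1))) =
        - (r * ((b i - a i) - (b (i + 1) - a (i + 1)))) := by ring
      rw [e, this, ← Finset.sum_neg_distrib]
      apply Finset.sum_congr rfl; intro j _; split_ifs <;> ring) (by
      intro i hi
      obtain rfl : i = k - 1 := by omega
      linarith)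
    have h1 : B ≤ A := Finset.sum_le_sum fun i hi => by
      have := hall i (Finset.mem_range.1 hi); linarith
    have h2 := hall 0 (by omega)
    nlinarith
  have hd : ∀ i, i < k → 0 ≤ b i - a i := tail_nonneg r hr (fun i => b i - a i) k hdd (by
    intro i hi
    obtain rfl : i = k - 1 := by omega
    exact hlastd)
  have hAB : A ≤ B := Finset.sum_le_sum fun i hi => by
    have := hd i (Finset.mem_range.1 hi); linarith
  have hBA : B ≤ A + P := by
    have := mul_nonneg hr.le (hd 0 (by omega))
    linarith
  have hsg : ∀ (f : ℕ → ℝ), (∀ i, i < k → 0 < f i) → ∀ i,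
      -∑ j ∈ Finset.range k, f j ≤ ∑ j ∈ Finset.range k, (if j ≤ i then 1 else -1) * f j := by
    intro f hf i
    rw [← Finset.sum_neg_distrib]
    apply Finset.sum_le_sum
    intro j hj
    have := hf j (Finset.mem_range.1 hj)
    split_ifs <;> linarith
  have hma : ∀ i, i + 1 < k → a i ≤ a (i + 1) := by
    intro i hi
    have h1 := hda i hi
    have h2 := hsg a ha i
    have : 0 ≤ r * (a (i + 1) - a i) := by rw [h1]; linarith
    linarith [nonneg_of_mul_nonneg_right this hr]
  have hmb : ∀ i, i + 1 < k → b i ≤ b (i + 1) := by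
    intro i hi
    have h1 := hdb i hi
    have h2 := hsg b hb i
    have : 0 ≤ r * (b (i + 1) - b i) := by rw [h1]; linarith
    linarith [nonneg_of_mul_nonneg_right this hr]
  have hca : ((k : ℝ) - 1) * A ≤ 2 * A1 := by
    have h1 := cheb a k hma
    have h2 := hlin a 2 (-((k : ℝ) - 1))
    simp only [← sub_eq_add_neg] at h2
    rw [h2] at h1; linarith
  have hcb : ((k : ℝ) - 1) * B ≤ 2 * B1 := by
    have h1 := cheb b k hmb
    have h2 := hlin b 2 (-((k : ℝ) - 1))
    simp only [← sub_eq_add_neg] at h2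
    rw [h2] at h1; linarith
  have hB1A1 : A1 ≤ B1 := Finset.sum_le_sum fun i hi => by
    have := hd i (Finset.mem_range.1 hi)
    exact mul_le_mul_of_nonneg_left (by linarith) (Nat.cast_nonneg _)
  have hge : ∀ i, i < k → a 0 ≤ a i := by
    intro i
    induction i with
    | zero => intro _; exact le_rfl
    | succ i ih => intro hi; exact (ih (by omega)).trans (hma i hi)
  have hAk : k * a 0 ≤ A := by
    have := Finset.sum_le_sum (s := Finset.range k) (f := fun _ => a 0) (g := a)
      (fun i hi => hge i (Finset.mem_range.1 hi))
    simpa using this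
  -- a 0 > p / 2
  have hA1A : A - a 0 ≤ A1 := by
    have h : ∑ j ∈ Finset.range k, (a j - (if j = 0 then a 0 else 0)) ≤ A1 := by
      apply Finset.sum_le_sum
      intro j hj
      have := ha j (Finset.mem_range.1 hj)
      split_ifs with h
      · subst h; simp
      · have : (1 : ℝ) ≤ j := by exact_mod_cast Nat.one_le_iff_ne_zero.2 h
        nlinarith
    rw [Finset.sum_sub_distrib, Finset.sum_ite_eq' ] at h
    rwa [if_pos (Finset.mem_range.2 (by omega))] at h
  have hpa : p / 2 < a 0 := by
    have : (r + 2) * p < (r + 2) * (2 * a 0) := by nlinarith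
    have := lt_of_mul_lt_mul_left this (by linarith)
    linarith
  have hAp : k * p / 2 ≤ A := by nlinarith
  -- final
  obtain ⟨c, hc⟩ : ∃ c : ℕ, c = (m + 1) / 2 := ⟨_, rfl⟩
  rw [← hc]
  have hc1 : (1 : ℝ) ≤ c := by exact_mod_cast (show 1 ≤ c by omega)
  have hF : (c * (k + 2) - k + 1) * A + c * (2 * m - 2) * p - k * m * p ≤
      r * (a 0 + c * p - b (k - 1)) := by
    have e : r * (a 0 + c * p - b (k - 1)) =
        c * (A1 + A + B1 + 2 * B + 2 * P - 2 * p) - k * A - k * P - (k - 2) * B + 2 * B1 := by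
      have : r * (a 0 + c * p - b (k - 1)) = r * a 0 + c * ((r + 2) * p - 2 * p)
        - r * b (k - 1) := by ring
      rw [this, hv0, hqq, hlast]; ring
    rw [e, hP]
    have h1 : (k + 2) * A ≤ A1 + A + B1 + 2 * B := by linarith
    have h2 := mul_le_mul_of_nonneg_left h1 (by linarith : (0 : ℝ) ≤ c)
    linarith
  have hpos : 0 < (c * (k + 2) - k + 1) * A + c * (2 * m - 2) * p - k * m * p := by
    by_cases hc2 : 2 ≤ c
    · refine final_ineq k c m A p (a 0) hkR (by exact_mod_cast hc2) ?_ hp hAp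
      rcases (show m = 2 * c ∨ m + 1 = 2 * c by omega) with h | h
      · left; exact_mod_cast h
      · right; rw [eq_sub_iff_add_eq]; exact_mod_cast h
    · have hc1' : c = 1 := by omega
      rcases (show m = 1 ∨ m = 2 by omega) with h | h
      · rw [hc1', h]; push_cast; nlinarith
      · have hP2 : P = 2 * p := by rw [hP, h]; norm_num
        have h5 : ((k : ℝ) - 1) * p < (k + 1) * a 0 := by
          have : r * (((k : ℝ) - 1) * p) < r * ((k + 1) * a 0) := by
            have e1 : r * (((k : ℝ) - 1) * p) = (k - 1) * ((r + 2) * p) - (k - 1) * (2 * p) := by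
              ring
            have e2 : r * ((k + 1) * a 0) = (k + 1) * (r * a 0) := by ring
            rw [e1, e2, hqq, hv0, hP2]
            linarith only [hca, hcb, hBpos, hp]
          exact lt_of_mul_lt_mul_left this hr.le
        rw [hc1', h]; push_cast
        have h6 : 0 < (k + 1) * (3 * A + 2 * p - 2 * k * p) := by
          have h7 := mul_le_mul_of_nonneg_left hAk (by linarith : (0 : ℝ) ≤ 3 * (k + 1))
          have h8 := mul_lt_mul_of_pos_left h5 (by linarith : (0 : ℝ) < 3 * k)
          have h9 : 0 ≤ ((k : ℝ) - 1) * (k - 2) * p := by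
            apply mul_nonneg (mul_nonneg _ _) hp.le <;> linarith
          nlinarith
        have := pos_of_mul_pos_right h6 (by linarith)
        linarith
  have := pos_of_mul_pos_right (hpos.trans_le hF) hr.le
  linarith

/-- Lemma 2.4 (second part): in the tree `T₁` with `m = n - 2k ≥ 1` pendant vertices at
`v_1`, the distance Perron vector satisfies `x_{v_1} + ⌈m/2⌉ · x_{v_n} > x_{u_k}`, where
`x_{v_n}` is the (common) entry at a pendant vertex. -/
theorem stmt6 (k m : ℕ) (hk : 2 ≤ k) (hm : 1 ≤ m)
    (X : (Fin k ⊕ (Fin k ⊕ Fin m)) → ℝ) (hX : IsDistPerronVector (treeT1 k m) X) :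
    ∀ j : Fin m,
      X (Sum.inl ⟨0, by omega⟩) + (((m + 1) / 2 : ℕ) : ℝ) * X (Sum.inr (Sum.inr j)) >
        X (Sum.inr (Sum.inl ⟨k - 1, by omega⟩)) := by
  intro q
  obtain ⟨hpos, -, heig⟩ := hX
  obtain ⟨r, hr⟩ : ∃ r, r = distSpectralRadius (treeT1 k m) := ⟨_, rfl⟩
  rw [← hr] at heig
  have hE : ∀ w, r * X w = ∑ j : Fin k, (dT k m w (Sum.inl j) : ℝ) * X (Sum.inl j)
      + (∑ j : Fin k, (dT k m w (Sum.inr (Sum.inl j)) : ℝ) * X (Sum.inr (Sum.inl j))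
      + ∑ j : Fin m, (dT k m w (Sum.inr (Sum.inr j)) : ℝ) * X (Sum.inr (Sum.inr j))) := by
    intro w
    have h := congrFun heig w
    simp only [Matrix.mulVec, dotProduct, distMatrix, dist_treeT1 k m hk, Fintype.sum_sum_type,
      Pi.smul_apply, smul_eq_mul] at h
    exact h.symm
  set a : ℕ → ℝ := fun i => if h : i < k then X (Sum.inl ⟨i, h⟩) else 0 with ha
  set b : ℕ → ℝ := fun i => if h : i < k then X (Sum.inr (Sum.inl ⟨i, h⟩)) else 0 with hb
  have haX : ∀ j : Fin k, X (Sum.inl j) = a j := fun j => by simp [ha]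
  have hbX : ∀ j : Fin k, X (Sum.inr (Sum.inl j)) = b j := fun j => by simp [hb]
  obtain ⟨P, hP⟩ : ∃ P, P = ∑ j : Fin m, X (Sum.inr (Sum.inr j)) := ⟨_, rfl⟩
  have hv : ∀ i, i < k → r * a i = ∑ j ∈ Finset.range k, ((i - j + (j - i) : ℕ) : ℝ) * a j
      + ∑ j ∈ Finset.range k, ((i : ℝ) + j + 1) * b j + ((i : ℝ) + 1) * P := by
    intro i hi
    have h := hE (Sum.inl ⟨i, hi⟩)
    simp only [dT, haX, hbX] at h
    rw [← Finset.mul_sum, ← hP] at h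
    rw [h, Finset.sum_range, Finset.sum_range]
    push_cast; ring
  have hu : ∀ i, i < k → r * b i = ∑ j ∈ Finset.range k, ((i : ℝ) + j + 1) * a j
      + ∑ j ∈ Finset.range k, ((i - j + (j - i) : ℕ) : ℝ) * b j + ((i : ℝ) + 2) * P := by
    intro i hi
    have h := hE (Sum.inr (Sum.inl ⟨i, hi⟩))
    simp only [dT, haX, hbX] at h
    rw [← Finset.mul_sum, ← hP] at h
    rw [h, Finset.sum_range, Finset.sum_range]
    push_cast; ring
  have hq : ∀ q : Fin m, (r + 2) * X (Sum.inr (Sum.inr q)) =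
      ∑ j ∈ Finset.range k, ((j : ℝ) + 1) * a j
      + ∑ j ∈ Finset.range k, ((j : ℝ) + 2) * b j + 2 * P := by
    intro q
    have h := hE (Sum.inr (Sum.inr q))
    simp only [dT, haX, hbX] at h
    have e : ∑ j : Fin m, ((if q = j then 0 else 2 : ℕ) : ℝ) * X (Sum.inr (Sum.inr j)) =
        2 * P - 2 * X (Sum.inr (Sum.inr q)) := by
      have : ∀ j : Fin m, ((if q = j then 0 else 2 : ℕ) : ℝ) * X (Sum.inr (Sum.inr j)) =
          2 * X (Sum.inr (Sum.inr j)) - (if q = j then 2 * X (Sum.inr (Sum.inr j)) else 0) := by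
        intro j; split_ifs <;> simp
      rw [Finset.sum_congr rfl (fun j _ => this j), Finset.sum_sub_distrib, Finset.sum_ite_eq,
        if_pos (Finset.mem_univ _), ← Finset.mul_sum, ← hP]
    rw [e] at h
    rw [add_mul, h, Finset.sum_range, Finset.sum_range]
    push_cast; ring
  have hrpos : 0 ≤ r := by
    have h1 : 0 ≤ r * X (Sum.inr (Sum.inr q)) := by
      rw [hE]
      have := fun w => (hpos w).le
      refine add_nonneg ?_ (add_nonneg ?_ ?_) <;>
        exact Finset.sum_nonneg fun j _ => mul_nonneg (Nat.cast_nonneg _) (this _)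
    exact nonneg_of_mul_nonneg_left h1 (hpos _)
  have hPm : P = m * X (Sum.inr (Sum.inr q)) := by
    have : ∀ j : Fin m, X (Sum.inr (Sum.inr j)) = X (Sum.inr (Sum.inr q)) := by
      intro j
      have h := (hq j).trans (hq q).symm
      exact mul_left_cancel₀ (by linarith) h
    rw [hP, Finset.sum_congr rfl (fun j _ => this j)]; simp
  have hfin := core k m hk hm r (X (Sum.inr (Sum.inr q))) P a b
    (fun i hi => by simp only [ha, dif_pos hi]; exact hpos _)
    (fun i hi => by simp only [hb, dif_pos hi]; exact hpos _) (hpos _) hPm hv hu (hq q)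
  have e1 : a 0 = X (Sum.inl ⟨0, by omega⟩) := by simp only [ha]; rw [dif_pos]
  have e2 : b (k - 1) = X (Sum.inr (Sum.inl ⟨k - 1, by omega⟩)) := by simp only [hb]; rw [dif_pos]
  rw [e1, e2] at hfin
  exact hfin
end

section
/- Among all trees with n vertices and odd diameter d = 2k−1 (k ≥ 2), the tree with the minimum distance spectral radius is uniquely T_1, the tree obtained by attaching n − 2k pendant vertices to vertex v_1 of the path v_k v_{k−1} ⋯ v_1 u_1 u_2 ⋯ u_k. That is, for every tree T on n vertices with diameter 2k−1, ϱ(T) ≥ ϱ(T_1), with equality if and only if T is isomorphic to T_1. -/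
open SimpleGraph

lemma distMatrix_isHermitian {V : Type*} [Fintype V] (G : SimpleGraph V) :
    (distMatrix G).IsHermitian := by
  ext i j
  simp [distMatrix, Matrix.conjTranspose_apply, SimpleGraph.dist_comm]

lemma eigSet_finite {V : Type*} [Fintype V] (G : SimpleGraph V) :
    {μ : ℝ | ∃ X : V → ℝ, X ≠ 0 ∧ (distMatrix G).mulVec X = μ • X}.Finite := by
  classical
  refine (Module.End.finite_hasEigenvalue (Matrix.toLin' (distMatrix G))).subset ?_
  rintro μ ⟨X, hX, h⟩
  exact Module.End.hasEigenvalue_of_hasEigenvector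
    (Module.End.hasEigenvector_iff.2 ⟨Module.End.mem_eigenspace_iff.2 (by simpa using h), hX⟩)

lemma posSemidef_aux {V : Type*} [Fintype V] [DecidableEq V] (G : SimpleGraph V) :
    (distSpectralRadius G • (1 : Matrix V V ℝ) - distMatrix G).PosSemidef := by
  have hH : (distSpectralRadius G • (1 : Matrix V V ℝ) - distMatrix G).IsHermitian := by
    refine Matrix.IsHermitian.sub ?_ (distMatrix_isHermitian G)
    ext i j
    simp [Matrix.one_apply, eq_comm]
  rw [hH.posSemidef_iff_eigenvalues_nonneg]
  intro i
  have h := hH.mulVec_eigenvectorBasis i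
  have hne : (hH.eigenvectorBasis i : EuclideanSpace ℝ V) ≠ 0 :=
    hH.eigenvectorBasis.orthonormal.ne_zero i
  have hmem : distSpectralRadius G - hH.eigenvalues i ∈
      {μ : ℝ | ∃ X : V → ℝ, X ≠ 0 ∧ (distMatrix G).mulVec X = μ • X} := by
    refine ⟨(hH.eigenvectorBasis i).ofLp, ?_, ?_⟩
    · intro h0
      apply hne
      ext j
      exact congrFun h0 j
    · rw [Matrix.sub_mulVec, Matrix.smul_mulVec, Matrix.one_mulVec] at h
      rw [sub_smul, ← h]
      abel
  have := le_csSup (eigSet_finite G).bddAbove hmem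
  change _ ≤ distSpectralRadius G at this
  simp only [Pi.zero_apply]
  linarith

lemma quad_eq {V : Type*} [Fintype V] [DecidableEq V] (G : SimpleGraph V) (x : V → ℝ) :
    star x ⬝ᵥ ((distSpectralRadius G • (1 : Matrix V V ℝ) - distMatrix G).mulVec x)
     = distSpectralRadius G * ∑ i, x i ^ 2 - ∑ i, ∑ j, (G.dist i j : ℝ) * x i * x j := by
  rw [Matrix.sub_mulVec, Matrix.smul_mulVec, Matrix.one_mulVec]
  simp only [dotProduct, Matrix.mulVec, distMatrix, Pi.sub_apply, Pi.smul_apply, smul_eq_mul,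
    star_trivial]
  rw [Finset.mul_sum, ← Finset.sum_sub_distrib]
  refine Finset.sum_congr rfl fun i _ => ?_
  rw [mul_sub, Finset.mul_sum]
  congr 1
  · ring
  · exact Finset.sum_congr rfl fun j _ => by ring

lemma rayleigh {V : Type*} [Fintype V] (G : SimpleGraph V) (x : V → ℝ) :
    ∑ i, ∑ j, (G.dist i j : ℝ) * x i * x j ≤ distSpectralRadius G * ∑ i, x i ^ 2 := by
  classical
  have := (posSemidef_aux G).dotProduct_mulVec_nonneg x
  rw [quad_eq] at this
  linarith

lemma exists_eig {V : Type*} [Fintype V] [Nonempty V] (G : SimpleGraph V) :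
    ∃ X : V → ℝ, X ≠ 0 ∧ (distMatrix G).mulVec X = distSpectralRadius G • X := by
  classical
  have hH := distMatrix_isHermitian G
  have hne : {μ : ℝ | ∃ X : V → ℝ, X ≠ 0 ∧ (distMatrix G).mulVec X = μ • X}.Nonempty := by
    obtain ⟨i⟩ := ‹Nonempty V›
    refine ⟨hH.eigenvalues i, (hH.eigenvectorBasis i).ofLp, ?_, hH.mulVec_eigenvectorBasis i⟩
    intro h0
    apply hH.eigenvectorBasis.orthonormal.ne_zero i
    ext j
    exact congrFun h0 j
  exact hne.csSup_mem (eigSet_finite G)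

lemma exists_perron {V : Type*} [Fintype V] [Nontrivial V] (G : SimpleGraph V)
    (hG : G.Connected) :
    ∃ y : V → ℝ, (∀ v, 0 < y v) ∧
      (∀ v, ∑ w, (G.dist v w : ℝ) * y w = distSpectralRadius G * y v) := by
  classical
  obtain ⟨X, hX, hE⟩ := exists_eig G
  have hEv : ∀ v, ∑ w, (G.dist v w : ℝ) * X w = distSpectralRadius G * X v := by
    intro v
    have := congrFun hE v
    simpa [Matrix.mulVec, dotProduct, distMatrix] using this
  have h1 : ∑ i, ∑ j, (G.dist i j : ℝ) * X i * X j = distSpectralRadius G * ∑ i, X i ^ 2 := by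
    rw [Finset.mul_sum]
    refine Finset.sum_congr rfl fun i _ => ?_
    have := hEv i
    calc ∑ j, (G.dist i j : ℝ) * X i * X j = X i * ∑ j, (G.dist i j : ℝ) * X j := by
          rw [Finset.mul_sum]; exact Finset.sum_congr rfl fun j _ => by ring
      _ = _ := by rw [this]; ring
  have h2 : ∑ i, ∑ j, (G.dist i j : ℝ) * X i * X j ≤
      ∑ i, ∑ j, (G.dist i j : ℝ) * |X i| * |X j| := by
    refine Finset.sum_le_sum fun i _ => Finset.sum_le_sum fun j _ => ?_
    rw [mul_assoc, mul_assoc, ← abs_mul]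
    exact mul_le_mul_of_nonneg_left (le_abs_self _) (Nat.cast_nonneg _)
  have h3 := rayleigh G (fun v => |X v|)
  simp only [sq_abs] at h3
  have h4 : star (fun v => |X v|) ⬝ᵥ
      ((distSpectralRadius G • (1 : Matrix V V ℝ) - distMatrix G).mulVec (fun v => |X v|)) = 0 := by
    rw [quad_eq]
    simp only [sq_abs]
    linarith
  rw [(posSemidef_aux G).dotProduct_mulVec_zero_iff] at h4
  have hev : ∀ v, ∑ w, (G.dist v w : ℝ) * |X w| = distSpectralRadius G * |X v| := by
    intro v
    have := congrFun h4 v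
    rw [Matrix.sub_mulVec, Matrix.smul_mulVec, Matrix.one_mulVec] at this
    simp [Matrix.mulVec, dotProduct, distMatrix] at this
    linarith
  refine ⟨fun v => |X v|, ?_, hev⟩
  intro v
  by_contra hv
  have hv0 : |X v| = 0 := le_antisymm (not_lt.1 hv) (abs_nonneg _)
  have hs := hev v
  rw [hv0, mul_zero, Finset.sum_eq_zero_iff_of_nonneg
    (fun w _ => mul_nonneg (Nat.cast_nonneg _) (abs_nonneg _))] at hs
  apply hX
  ext w
  by_cases hw : v = w
  · subst hw; simpa using hv0
  · have := hs w (Finset.mem_univ _)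
    have hd : 0 < G.dist v w := hG.pos_dist_of_ne hw
    rcases mul_eq_zero.1 this with h | h
    · exact absurd h (by exact_mod_cast hd.ne')
    · simpa using h

lemma dist_eq_of_formula {V : Type*} (G : SimpleGraph V) (a : V) (F : V → ℕ)
    (h0 : ∀ z, F z = 0 ↔ z = a)
    (h1 : ∀ z z', G.Adj z z' → F z' ≤ F z + 1)
    (h2 : ∀ z, F z ≠ 0 → ∃ z', G.Adj z' z ∧ F z' + 1 = F z) :
    ∀ z, G.Reachable a z ∧ G.dist a z = F z := by
  have key : ∀ n z, F z = n → ∃ p : G.Walk a z, p.length = n := by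
    intro n
    induction n with
    | zero =>
      intro z hz
      have := (h0 z).1 hz
      subst this
      exact ⟨SimpleGraph.Walk.nil, rfl⟩
    | succ n ih =>
      intro z hz
      obtain ⟨z', hadj, hz'⟩ := h2 z (by omega)
      obtain ⟨p, hp⟩ := ih z' (by omega)
      exact ⟨p.concat hadj, by simp [hp]⟩
  have low : ∀ {u z : V} (p : G.Walk u z), F z ≤ F u + p.length := by
    intro u z p
    induction p with
    | nil => simp
    | cons h p ih =>
      have := h1 _ _ h
      simp only [SimpleGraph.Walk.length_cons]
      omega
  intro z
  obtain ⟨p, hp⟩ := key _ z rfl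
  have hr : G.Reachable a z := ⟨p⟩
  refine ⟨hr, le_antisymm (hp ▸ SimpleGraph.dist_le p) ?_⟩
  obtain ⟨q, hq⟩ := hr.exists_walk_length_eq_dist
  have := low q
  rw [(h0 a).2 rfl] at this
  omega

/-- position along the spine; the vertex `v_1` is at the origin -/
def t1pos {k m : ℕ} : Fin k ⊕ (Fin k ⊕ Fin m) → ℤ
  | Sum.inl i => -(i : ℤ)
  | Sum.inr (Sum.inl j) => (j : ℤ) + 1
  | Sum.inr (Sum.inr _) => 0

/-- height above the spine -/
def t1ht {k m : ℕ} : Fin k ⊕ (Fin k ⊕ Fin m) → ℤ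
  | Sum.inl _ => 0
  | Sum.inr (Sum.inl _) => 0
  | Sum.inr (Sum.inr _) => 1

/-- the distance formula in `treeT1` -/
def t1F {k m : ℕ} (a b : Fin k ⊕ (Fin k ⊕ Fin m)) : ℕ :=
  if a = b then 0 else (|t1pos a - t1pos b| + t1ht a + t1ht b).toNat

lemma t1_dist {k m : ℕ} (hk : 2 ≤ k) (a b : Fin k ⊕ (Fin k ⊕ Fin m)) :
    (treeT1 k m).Reachable a b ∧ (treeT1 k m).dist a b = t1F a b := by
  refine dist_eq_of_formula (treeT1 k m) a (fun b => t1F a b) ?_ ?_ ?_ b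
  · intro z
    rcases a with i | i | i <;> rcases z with j | j | j <;>
      simp [t1F, t1pos, t1ht, Fin.ext_iff] <;> omega
  · intro z z' h
    rcases a with i | i | i <;> rcases z with j | j | j <;> rcases z' with l | l | l <;>
      simp [t1F, t1pos, t1ht, treeT1, Fin.ext_iff] at h ⊢ <;> grind
  · intro z hz
    rcases z with j | j | j
    · by_cases hc : t1pos a < -(j : ℤ) ∨ (j : ℕ) = 0
      · by_cases hj : (j : ℕ) = 0
        · by_cases ha : t1pos a < 0
          · refine ⟨Sum.inl ⟨1, by omega⟩, ?_, ?_⟩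
            · simp [treeT1, Fin.ext_iff]; omega
            · rcases a with i | i | i <;> simp [t1F, t1pos, t1ht, Fin.ext_iff] at hz ha ⊢ <;> grind
          · rcases a with i | i | i
            · exfalso
              simp [t1F, t1pos, t1ht, Fin.ext_iff] at hz ha
              omega
            · refine ⟨Sum.inr (Sum.inl ⟨0, by omega⟩), ?_, ?_⟩
              · simp [treeT1]; omega
              · simp [t1F, t1pos, t1ht, Fin.ext_iff] at hz ha ⊢ <;> grind
            · refine ⟨Sum.inr (Sum.inr i), ?_, ?_⟩
              · simp [treeT1]; omega
              · simp [t1F, t1pos, t1ht, Fin.ext_iff] at hz ha ⊢ <;> grind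
        · have hlt : (j : ℕ) + 1 < k := by
            rcases a with i | i | i <;> simp [t1pos] at hc <;> omega
          refine ⟨Sum.inl ⟨j + 1, hlt⟩, ?_, ?_⟩
          · simp [treeT1, Fin.ext_iff]
          · rcases a with i | i | i <;> simp [t1F, t1pos, t1ht, Fin.ext_iff] at hz hc ⊢ <;> grind
      · refine ⟨Sum.inl ⟨j - 1, by omega⟩, ?_, ?_⟩
        · simp [treeT1, Fin.ext_iff]; omega
        · rcases a with i | i | i <;> simp [t1F, t1pos, t1ht, Fin.ext_iff] at hz hc ⊢ <;> grind
    · by_cases hc : (j : ℤ) + 1 < t1pos a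
      · have hlt : (j : ℕ) + 1 < k := by
          rcases a with i | i | i <;> simp [t1pos] at hc <;> omega
        refine ⟨Sum.inr (Sum.inl ⟨j + 1, hlt⟩), ?_, ?_⟩
        · simp [treeT1, Fin.ext_iff]
        · rcases a with i | i | i <;> simp [t1F, t1pos, t1ht, Fin.ext_iff] at hz hc ⊢ <;> grind
      · by_cases hj : (j : ℕ) = 0
        · refine ⟨Sum.inl ⟨0, by omega⟩, ?_, ?_⟩
          · simp [treeT1]; omega
          · rcases a with i | i | i <;> simp [t1F, t1pos, t1ht, Fin.ext_iff] at hz hc ⊢ <;> grind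
        · refine ⟨Sum.inr (Sum.inl ⟨j - 1, by omega⟩), ?_, ?_⟩
          · simp [treeT1, Fin.ext_iff]; omega
          · rcases a with i | i | i <;> simp [t1F, t1pos, t1ht, Fin.ext_iff] at hz hc ⊢ <;> grind
    · refine ⟨Sum.inl ⟨0, by omega⟩, ?_, ?_⟩
      · simp [treeT1]
      · rcases a with i | i | i <;> simp [t1F, t1pos, t1ht, Fin.ext_iff] at hz ⊢ <;> grind

lemma t1_connected {k m : ℕ} (hk : 2 ≤ k) : (treeT1 k m).Connected := by
  haveI : Nonempty (Fin k ⊕ (Fin k ⊕ Fin m)) := ⟨Sum.inl ⟨0, by omega⟩⟩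
  exact ⟨fun a b => (t1_dist hk a b).1⟩

lemma iso_dist {V W : Type*} {G : SimpleGraph V} {H : SimpleGraph W} (hH : H.Connected)
    (hG : G.Connected) (e : G ≃g H) (a b : V) : G.dist a b = H.dist (e a) (e b) := by
  apply le_antisymm
  · obtain ⟨p, hp⟩ := hH.exists_walk_length_eq_dist (e a) (e b)
    have := SimpleGraph.dist_le (p.map e.symm.toHom)
    simpa [hp] using this
  · obtain ⟨p, hp⟩ := hG.exists_walk_length_eq_dist a b
    have := SimpleGraph.dist_le (p.map e.toHom)
    simpa [hp] using this

lemma eig_subset {V W : Type*} [Fintype V] [Fintype W] {G : SimpleGraph V} {H : SimpleGraph W}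
    (e : V ≃ W) (he : ∀ a b, G.dist a b = H.dist (e a) (e b)) :
    {μ : ℝ | ∃ X : V → ℝ, X ≠ 0 ∧ (distMatrix G).mulVec X = μ • X} ⊆
      {μ : ℝ | ∃ X : W → ℝ, X ≠ 0 ∧ (distMatrix H).mulVec X = μ • X} := by
  rintro μ ⟨X, hX, h⟩
  refine ⟨X ∘ e.symm, ?_, ?_⟩
  · intro h0
    apply hX
    ext v
    simpa using congrFun h0 (e v)
  · ext w
    have := congrFun h (e.symm w)
    simp only [Matrix.mulVec, dotProduct, distMatrix, Pi.smul_apply] at this ⊢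
    rw [Function.comp_apply, ← this, ← e.sum_comp]
    refine Finset.sum_congr rfl fun v _ => ?_
    simp [he]

lemma iso_radius {V W : Type*} [Fintype V] [Fintype W] {G : SimpleGraph V} {H : SimpleGraph W}
    (hH : H.Connected) (hG : G.Connected) (e : G ≃g H) :
    distSpectralRadius G = distSpectralRadius H := by
  unfold distSpectralRadius
  congr 1
  apply Set.Subset.antisymm
  · exact eig_subset e.toEquiv (fun a b => iso_dist hH hG e a b)
  · exact eig_subset e.symm.toEquiv (fun a b => iso_dist hG hH e.symm a b)

lemma unique_parent {V : Type*} {T : SimpleGraph V} (hT : T.IsTree) {z x y₁ y₂ : V}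
    (h₁ : T.Adj x y₁) (h₂ : T.Adj x y₂) (d₁ : T.dist z y₁ < T.dist z x)
    (d₂ : T.dist z y₂ < T.dist z x) : y₁ = y₂ := by
  have hc := hT.connected
  have aux : ∀ y, T.Adj x y → T.dist z y < T.dist z x →
      ∃ p : T.Walk x z, p.IsPath ∧ p.getVert 1 = y := by
    intro y hy hd
    obtain ⟨p, hp⟩ := hc.exists_walk_length_eq_dist y z
    refine ⟨SimpleGraph.Walk.cons hy p, ?_, by simp⟩
    apply SimpleGraph.Walk.isPath_of_length_eq_dist
    have h1 := hc.dist_triangle (u := x) (v := y) (w := z)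
    rw [SimpleGraph.dist_eq_one_iff_adj.2 hy] at h1
    rw [SimpleGraph.dist_comm (u := z) (v := y), SimpleGraph.dist_comm (u := z) (v := x)] at hd
    rw [SimpleGraph.Walk.length_cons, hp]
    omega
  obtain ⟨p, hp, hp1⟩ := aux y₁ h₁ d₁
  obtain ⟨q, hq, hq1⟩ := aux y₂ h₂ d₂
  have := hT.isAcyclic.path_unique ⟨p, hp⟩ ⟨q, hq⟩
  have hpq : p = q := congrArg Subtype.val this
  rw [← hp1, ← hq1, hpq]

lemma tree_step {V : Type*} {T : SimpleGraph V} (hT : T.IsTree) (z : V) {x y : V}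
    (h : T.Adj x y) : T.dist z y = T.dist z x + 1 ∨ T.dist z x = T.dist z y + 1 := by
  have h1 := hT.dist_ne_of_adj z h
  have h2 := hT.connected.dist_triangle (u := z) (v := x) (w := y)
  have h3 := hT.connected.dist_triangle (u := z) (v := y) (w := x)
  rw [SimpleGraph.dist_eq_one_iff_adj.2 h] at h2
  rw [SimpleGraph.dist_eq_one_iff_adj.2 h.symm] at h3
  omega

lemma ray {V : Type*} {T : SimpleGraph V} (hT : T.IsTree) (w : V) (f : ℕ → V) (L : ℕ)
    (hadj : ∀ t, t < L → T.Adj (f t) (f (t + 1)))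
    (hnb : ∀ t, t + 2 ≤ L → f t ≠ f (t + 2))
    (h0 : T.dist w (f 0) < T.dist w (f 1)) :
    ∀ t, t ≤ L → T.dist w (f t) = T.dist w (f 0) + t := by
  intro t
  induction t using Nat.strong_induction_on with
  | _ t ih =>
    intro ht
    match t with
    | 0 => rfl
    | 1 =>
      have := tree_step hT w (hadj 0 (by omega))
      simp only [zero_add] at this
      omega
    | t + 2 =>
      have i0 := ih t (by omega) (by omega)
      have i1 := ih (t + 1) (by omega) (by omega)
      rcases tree_step hT w (hadj (t + 1) (by omega)) with h | h
      · show T.dist w (f (t + 1 + 1)) = _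
        omega
      · exfalso
        change _ = T.dist w (f (t + 2)) + 1 at h
        refine hnb t ht (unique_parent hT (z := w) (hadj t (by omega)).symm
          (hadj (t + 1) (by omega)) ?_ ?_)
        · omega
        · show T.dist w (f (t + 2)) < _
          omega

lemma exists_geod {V : Type*} {T : SimpleGraph V} (hc : T.Connected) (u v : V) :
    ∃ g : ℕ → V, g 0 = u ∧ g (T.dist u v) = v ∧
      (∀ t, t < T.dist u v → T.Adj (g t) (g (t + 1))) ∧
      (∀ i j, i ≤ T.dist u v → j ≤ T.dist u v → (T.dist (g i) (g j) : ℤ) = |(i : ℤ) - j|) := by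
  obtain ⟨p, hp⟩ := hc.exists_walk_length_eq_dist u v
  have hadj : ∀ t, t < T.dist u v → T.Adj (p.getVert t) (p.getVert (t + 1)) :=
    fun t ht => p.adj_getVert_succ (by omega)
  have h0 : p.getVert 0 = u := p.getVert_zero
  have hL : p.getVert (T.dist u v) = v := by rw [← hp]; exact p.getVert_length
  have up : ∀ d i, i + d ≤ T.dist u v → T.dist (p.getVert i) (p.getVert (i + d)) ≤ d := by
    intro d
    induction d with
    | zero => intro i _; simp
    | succ d ih =>
      intro i hi
      have h1 := hc.dist_triangle (u := p.getVert i) (v := p.getVert (i + d))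
        (w := p.getVert (i + d + 1))
      rw [SimpleGraph.dist_eq_one_iff_adj.2 (hadj (i + d) (by omega))] at h1
      have := ih i (by omega)
      show T.dist (p.getVert i) (p.getVert (i + d + 1)) ≤ _
      omega
  have main : ∀ i j, i ≤ j → j ≤ T.dist u v →
      T.dist (p.getVert i) (p.getVert j) = j - i := by
    intro i j hij hj
    have a1 := up (j - i) i (by omega)
    have a2 := up i 0 (by omega)
    have a3 := up (T.dist u v - j) j (by omega)
    rw [show i + (j - i) = j by omega] at a1
    rw [zero_add, h0] at a2
    rw [show j + (T.dist u v - j) = T.dist u v by omega, hL] at a3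
    have t1 := hc.dist_triangle (u := u) (v := p.getVert i) (w := v)
    have t2 := hc.dist_triangle (u := p.getVert i) (v := p.getVert j) (w := v)
    omega
  refine ⟨p.getVert, h0, hL, hadj, ?_⟩
  intro i j hi hj
  rcases le_total i j with h | h
  · rw [main i j h hj, abs_of_nonpos (by omega)]; omega
  · rw [SimpleGraph.dist_comm, main j i h hi, abs_of_nonneg (by omega)]; omega

/-- `g` traverses a geodesic with `L` edges -/
def IsGeod {V : Type*} (T : SimpleGraph V) (g : ℕ → V) (L : ℕ) : Prop :=
  ∀ i j, i ≤ L → j ≤ L → (T.dist (g i) (g j) : ℤ) = |(i : ℤ) - j|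

lemma IsGeod.adj {V : Type*} {T : SimpleGraph V} {g : ℕ → V} {L : ℕ} (hg : IsGeod T g L)
    (t : ℕ) (ht : t < L) : T.Adj (g t) (g (t + 1)) := by
  rw [← SimpleGraph.dist_eq_one_iff_adj]
  have := hg t (t + 1) (by omega) (by omega)
  push_cast at this
  rw [abs_of_nonpos (by omega)] at this
  omega

lemma IsGeod.inj {V : Type*} {T : SimpleGraph V} {g : ℕ → V} {L : ℕ} (hg : IsGeod T g L)
    {i j : ℕ} (hi : i ≤ L) (hj : j ≤ L) (h : g i = g j) : i = j := by
  have := hg i j hi hj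
  rw [h, SimpleGraph.dist_self] at this
  have h2 := abs_eq_zero.1 this.symm
  omega

lemma projection {V : Type*} {T : SimpleGraph V} (hT : T.IsTree) {g : ℕ → V} {L : ℕ}
    (hg : IsGeod T g L) (w : V) (hw : ∀ i, i ≤ L → g i ≠ w) :
    ∃ b h : ℕ, b ≤ L ∧ 1 ≤ h ∧ ∀ j, j ≤ L → (T.dist w (g j) : ℤ) = h + |(b : ℤ) - j| := by
  classical
  obtain ⟨b, hb, hmin⟩ := Finset.exists_min_image (Finset.range (L + 1))
    (fun i => T.dist w (g i)) ⟨0, by simp⟩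
  have hbL : b ≤ L := by simpa [Nat.lt_succ_iff] using hb
  have hmin' : ∀ i, i ≤ L → T.dist w (g b) ≤ T.dist w (g i) :=
    fun i hi => hmin i (by simp; omega)
  refine ⟨b, T.dist w (g b), hbL,
    hT.connected.pos_dist_of_ne (fun h => hw b hbL h.symm), ?_⟩
  intro j hj
  rcases le_total b j with h | h
  · rcases Nat.eq_or_lt_of_le h with h | h
    · subst h; simp
    have := ray hT w (fun t => g (b + t)) (L - b) (fun t ht => hg.adj (b + t) (by omega))
      (fun t ht he => by have := hg.inj (by omega) (by omega) he; omega)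
      (by
        have h1 := hmin' (b + 1) (by omega)
        have h2 := tree_step hT w (hg.adj b (by omega))
        show T.dist w (g b) < T.dist w (g (b + 1))
        omega) (j - b) (by omega)
    simp only [show b + (j - b) = j by omega, add_zero] at this
    rw [this, abs_of_nonpos (by omega)]
    push_cast [h.le]
    omega
  · rcases Nat.eq_or_lt_of_le h with h | h
    · subst h; simp
    have := ray hT w (fun t => g (b - t)) b
      (fun t ht => by
        have := hg.adj (b - (t + 1)) (by omega)
        rw [show b - (t + 1) + 1 = b - t by omega] at this
        exact this.symm)
      (fun t ht he => by have := hg.inj (by omega) (by omega) he; omega)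
      (by
        have h1 := hmin' (b - 1) (by omega)
        have h3 := hg.adj (b - 1) (by omega)
        rw [show b - 1 + 1 = b by omega] at h3
        have h2 := tree_step hT w h3
        show T.dist w (g b) < T.dist w (g (b - 1))
        omega) (b - j) (by omega)
    simp only [show b - (b - j) = j by omega, tsub_zero] at this
    rw [this, abs_of_nonneg (by omega)]
    push_cast [h.le]
    omega

lemma cross_aux {V : Type*} {T : SimpleGraph V} (hT : T.IsTree) {g : ℕ → V} {L : ℕ}
    (hg : IsGeod T g L) {w w' : V} {b h b' h' : ℕ} (hbb : b < b') (hb' : b' ≤ L) (hh : 1 ≤ h')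
    (hw : ∀ j, j ≤ L → (T.dist w (g j) : ℤ) = h + |(b : ℤ) - j|)
    (hw' : ∀ j, j ≤ L → (T.dist w' (g j) : ℤ) = h' + |(b' : ℤ) - j|) :
    (T.dist w w' : ℤ) = h + h' + |(b : ℤ) - b'| := by
  obtain ⟨q, q0, qL, -, qg⟩ := exists_geod hT.connected (g b') w'
  have hq : IsGeod T q (T.dist (g b') w') := qg
  have hl : T.dist (g b') w' = h' := by
    have := hw' b' hb'
    rw [SimpleGraph.dist_comm]
    simp at this
    exact this
  rw [hl] at hq qL
  have e0 := hw (b' - 1) (by omega)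
  have e1 := hw b' hb'
  rw [abs_of_nonpos (by omega)] at e0 e1
  have := ray hT w (fun t => if t = 0 then g (b' - 1) else q (t - 1)) (h' + 1)
    (fun t ht => by
      rcases t with _ | t
      · have := hg.adj (b' - 1) (by omega)
        rw [show b' - 1 + 1 = b' by omega] at this
        simpa [q0] using this
      · simpa using hq.adj t (by omega))
    (fun t ht he => by
      rcases t with _ | t
      · simp at he
        have h1 := hw' (b' - 1) (by omega)
        have h2 := hq 1 h' (by omega) le_rfl
        rw [qL, ← he, SimpleGraph.dist_comm, h1] at h2
        rw [abs_of_nonneg (by omega), abs_of_nonpos (by omega)] at h2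
        omega
      · simp at he
        have := hq.inj (by omega) (by omega) he
        omega)
    (by simp [q0]; omega) (h' + 1) le_rfl
  simp [qL] at this
  rw [this, abs_of_nonpos (by omega)]
  push_cast
  omega

lemma cross {V : Type*} {T : SimpleGraph V} (hT : T.IsTree) {g : ℕ → V} {L : ℕ}
    (hg : IsGeod T g L) {w w' : V} {b h b' h' : ℕ} (hbb : b ≠ b') (hb : b ≤ L) (hb' : b' ≤ L)
    (hh : 1 ≤ h) (hh' : 1 ≤ h')
    (hw : ∀ j, j ≤ L → (T.dist w (g j) : ℤ) = h + |(b : ℤ) - j|)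
    (hw' : ∀ j, j ≤ L → (T.dist w' (g j) : ℤ) = h' + |(b' : ℤ) - j|) :
    (T.dist w w' : ℤ) = h + h' + |(b : ℤ) - b'| := by
  rcases lt_or_gt_of_ne hbb with h1 | h1
  · exact cross_aux hT hg h1 hb' hh' hw hw'
  · rw [SimpleGraph.dist_comm, cross_aux hT hg h1 hb hh hw' hw, abs_sub_comm]
    ring

/-- position of the path vertices -/
def ps {k : ℕ} : Fin k ⊕ Fin k → ℤ
  | Sum.inl i => -(i : ℤ)
  | Sum.inr j => (j : ℤ) + 1

/-- combinatorial data extracted from a tree with a diametral path -/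
structure TData {V : Type*} (T : SimpleGraph V) (k m : ℕ) where
  e : (Fin k ⊕ Fin k) ⊕ Fin m ≃ V
  b : Fin m → ℤ
  h : Fin m → ℤ
  par : Fin m → Fin m → ℤ
  c1 : ∀ s t, (T.dist (e (Sum.inl s)) (e (Sum.inl t)) : ℤ) = |ps s - ps t|
  c2 : ∀ j s, (T.dist (e (Sum.inr j)) (e (Sum.inl s)) : ℤ) = h j + |b j - ps s|
  c3 : ∀ j, 1 ≤ h j
  c4 : ∀ j j', j ≠ j' →
    2 + |b j - b j'| - par j j' - par j' j ≤ (T.dist (e (Sum.inr j)) (e (Sum.inr j')) : ℤ)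
  c5 : ∀ j j', 0 ≤ par j j'
  c6 : ∀ j, ∑ j', par j j' ≤ h j - 1

lemma ps_swap {k : ℕ} (s : Fin k ⊕ Fin k) : ps s.swap = 1 - ps s := by
  rcases s with i | i <;> simp [ps] <;> ring

def TData.flip {V : Type*} {T : SimpleGraph V} {k m : ℕ} (D : TData T k m) : TData T k m where
  e := (Equiv.sumCongr (Equiv.sumComm _ _) (Equiv.refl _)).trans D.e
  b := fun j => 1 - D.b j
  h := D.h
  par := D.par
  c1 := fun s t => by
    simp [D.c1, ps_swap, abs_sub_comm]
  c2 := fun j s => by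
    simp only [Equiv.trans_apply, Equiv.sumCongr_apply, Sum.map_inr, Sum.map_inl,
      Equiv.refl_apply, Equiv.sumComm_apply, D.c2, ps_swap]
    rw [abs_sub_comm, show 1 - ps s - D.b j = 1 - D.b j - ps s by ring]
  c3 := D.c3
  c4 := fun j j' hj => by
    have := D.c4 j j' hj
    simpa [abs_sub_comm] using this
  c5 := D.c5
  c6 := D.c6

lemma exists_tdata {V : Type*} [Fintype V] {T : SimpleGraph V} (hT : T.IsTree) {k m : ℕ}
    (hk : 2 ≤ k) (hcard : Fintype.card V = 2 * k + m) (hdiam : T.diam = 2 * k - 1) :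
    Nonempty (TData T k m) := by
  classical
  have hc := hT.connected
  have : Nonempty V := hc.nonempty
  obtain ⟨u, v, huv⟩ := T.exists_dist_eq_diam
  obtain ⟨g, -, -, -, hg0⟩ := exists_geod hc u v
  rw [huv, hdiam] at hg0
  have hg : IsGeod T g (2 * k - 1) := hg0
  let idx : Fin k ⊕ Fin k → ℕ := fun s => (ps s + (k - 1)).toNat
  have hidx : ∀ s, (idx s : ℤ) = ps s + (k - 1) := by
    intro s
    apply Int.toNat_of_nonneg
    rcases s with i | i <;> simp [ps] <;> omega
  have hidxle : ∀ s, idx s ≤ 2 * k - 1 := by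
    intro s
    have := hidx s
    rcases s with i | i <;> simp only [ps] at this <;> omega
  have hsurj : ∀ i, i ≤ 2 * k - 1 → ∃ s, idx s = i := by
    intro i hi
    by_cases hik : i < k
    · refine ⟨Sum.inl ⟨k - 1 - i, by omega⟩, ?_⟩
      have := hidx (Sum.inl ⟨k - 1 - i, by omega⟩)
      simp only [ps] at this
      omega
    · refine ⟨Sum.inr ⟨i - k, by omega⟩, ?_⟩
      have := hidx (Sum.inr ⟨i - k, by omega⟩)
      simp only [ps] at this
      omega
  let q : Fin k ⊕ Fin k → V := fun s => g (idx s)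
  have hqinj : Function.Injective q := by
    intro s t hst
    have h1 := hg.inj (hidxle s) (hidxle t) hst
    have h2 := hidx s
    have h3 := hidx t
    rcases s with i | i <;> rcases t with j | j <;> simp only [ps] at h2 h3 <;>
      simp [Fin.ext_iff] <;> omega
  have hcompl : Fintype.card {x // x ∉ Set.range q} = m := by
    rw [Fintype.card_subtype_compl]
    have : Fintype.card {x // x ∈ Set.range q} = Fintype.card (Fin k ⊕ Fin k) :=
      (Fintype.card_congr (Equiv.ofInjective q hqinj)).symm
    rw [this, hcard]
    simp
    omega
  let e2 : Fin m ≃ {x // x ∉ Set.range q} := (Fintype.equivFinOfCardEq hcompl).symm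
  let e : (Fin k ⊕ Fin k) ⊕ Fin m ≃ V :=
    (Equiv.sumCongr (Equiv.ofInjective q hqinj) e2).trans (Equiv.Set.sumCompl (Set.range q))
  have he1 : ∀ s, e (Sum.inl s) = g (idx s) := fun s => rfl
  have he2 : ∀ j i, i ≤ 2 * k - 1 → g i ≠ e (Sum.inr j) := by
    intro j i hi h
    obtain ⟨s, hs⟩ := hsurj i hi
    rw [← hs, ← he1] at h
    exact absurd (e.injective h) (by simp)
  choose b h hb hh hd using fun j => projection hT hg (e (Sum.inr j)) (he2 j)
  let par : Fin m → Fin m → ℤ := fun j j' =>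
    if T.Adj (e (Sum.inr j)) (e (Sum.inr j')) ∧
      T.dist (g 0) (e (Sum.inr j')) < T.dist (g 0) (e (Sum.inr j)) then 1 else 0
  have hpar0 : ∀ j j', 0 ≤ par j j' := by
    intro j j'
    simp only [par]
    split_ifs <;> norm_num
  refine ⟨⟨e, fun j => (b j : ℤ) - (k - 1), fun j => h j, par, ?_, ?_, ?_, ?_, hpar0, ?_⟩⟩
  · intro s t
    rw [he1, he1, hg _ _ (hidxle s) (hidxle t), hidx, hidx]
    congr 1
    ring
  · intro j s
    rw [he1, hd j _ (hidxle s), hidx]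
    congr 2
    ring
  · intro j
    exact_mod_cast hh j
  · intro j j' hj
    have hne : e (Sum.inr j) ≠ e (Sum.inr j') := by simpa using hj
    rw [show (b j : ℤ) - (k - 1) - ((b j' : ℤ) - (k - 1)) = (b j : ℤ) - b j' by ring]
    have p1 := hpar0 j j'
    have p2 := hpar0 j' j
    by_cases hbb : b j = b j'
    · rw [hbb, sub_self, abs_zero]
      by_cases hadj : T.Adj (e (Sum.inr j)) (e (Sum.inr j'))
      · have h1 := SimpleGraph.dist_eq_one_iff_adj.2 hadj
        have : par j j' = 1 ∨ par j' j = 1 := by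
          rcases tree_step hT (g 0) hadj with h2 | h2
          · right
            simp only [par]
            rw [if_pos ⟨hadj.symm, by omega⟩]
          · left
            simp only [par]
            rw [if_pos ⟨hadj, by omega⟩]
        omega
      · have := hc.one_lt_dist_of_ne_of_not_adj hne hadj
        omega
    · rw [cross hT hg hbb (hb j) (hb j') (hh j) (hh j') (hd j) (hd j')]
      have := hh j
      have := hh j'
      omega
  · intro j
    by_cases hex : ∃ j0, par j j0 ≠ 0
    · obtain ⟨j0, hj0⟩ := hex
      have hP : ∀ j1, par j j1 ≠ 0 → T.Adj (e (Sum.inr j)) (e (Sum.inr j1)) ∧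
          T.dist (g 0) (e (Sum.inr j1)) < T.dist (g 0) (e (Sum.inr j)) := by
        intro j1 h1
        by_contra hcon
        apply h1
        simp only [par]
        rw [if_neg hcon]
      obtain ⟨hadj, hlt⟩ := hP j0 hj0
      rw [Finset.sum_eq_single j0]
      · have hp1 : par j j0 = 1 := by
          simp only [par]
          rw [if_pos ⟨hadj, hlt⟩]
        rw [hp1]
        have hbb : b j = b j0 := by
          by_contra hbb
          have := cross hT hg hbb (hb j) (hb j0) (hh j) (hh j0) (hd j) (hd j0)
          rw [SimpleGraph.dist_eq_one_iff_adj.2 hadj] at this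
          have h1 := hh j
          have h2 := hh j0
          have h3 := abs_nonneg ((b j : ℤ) - b j0)
          omega
        have d1 := hd j 0 (by omega)
        have d2 := hd j0 0 (by omega)
        rw [SimpleGraph.dist_comm] at d1 d2
        rw [hbb] at d1
        have h2 := hh j0
        omega
      · intro j1 _ hj1
        by_contra hne
        obtain ⟨hadj1, hlt1⟩ := hP j1 hne
        have := unique_parent hT hadj hadj1 hlt hlt1
        apply hj1
        simpa using this.symm
      · simp
    · push Not at hex
      rw [Finset.sum_eq_zero (fun j' _ => hex j')]
      have := hh j
      omega

/-- the distance formula for `treeT1`, re-indexed -/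
def d1 {k m : ℕ} : (Fin k ⊕ Fin k) ⊕ Fin m → (Fin k ⊕ Fin k) ⊕ Fin m → ℤ
  | Sum.inl s, Sum.inl t => |ps s - ps t|
  | Sum.inl s, Sum.inr _ => 1 + |ps s|
  | Sum.inr _, Sum.inl t => 1 + |ps t|
  | Sum.inr j, Sum.inr j' => if j = j' then 0 else 2

lemma minsum_aux (k : ℕ) (i j : Fin k) :
    ((i : ℝ) + j + 1 - |(i : ℝ) - j|) =
      1 + 2 * ∑ r ∈ Finset.range k, (if r < (i : ℕ) then (1 : ℝ) else 0) *
        (if r < (j : ℕ) then (1 : ℝ) else 0) := by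
  have h : ∑ r ∈ Finset.range k, (if r < (i : ℕ) then (1 : ℝ) else 0) *
        (if r < (j : ℕ) then (1 : ℝ) else 0) = ((min (i : ℕ) j : ℕ) : ℝ) := by
    have : ∀ r, (if r < (i : ℕ) then (1 : ℝ) else 0) *
        (if r < (j : ℕ) then (1 : ℝ) else 0) = if r ∈ Finset.range (min (i : ℕ) j) then 1 else 0 := by
      intro r
      simp only [Finset.mem_range, lt_min_iff]
      split_ifs <;> simp_all
    simp only [this]
    rw [Finset.sum_ite_mem, Finset.inter_eq_right.2]
    · simp
    · intro r hr
      simp at hr ⊢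
      omega
  rw [h]
  rcases le_total (i : ℕ) j with hij | hij
  · have : (i : ℝ) ≤ j := by exact_mod_cast hij
    rw [min_eq_left hij, abs_of_nonpos (by linarith)]
    ring
  · have : (j : ℝ) ≤ i := by exact_mod_cast hij
    rw [min_eq_right hij, abs_of_nonneg (by linarith)]
    ring

lemma quad_min (k : ℕ) (δ : Fin k → ℝ) :
    (∑ i, δ i) ^ 2 ≤ ∑ i, ∑ j : Fin k, δ i * δ j * ((i : ℝ) + j + 1 - |(i : ℝ) - j|) := by
  have h : ∑ i, ∑ j : Fin k, δ i * δ j * ((i : ℝ) + j + 1 - |(i : ℝ) - j|)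
      = (∑ i, δ i) ^ 2 + 2 * ∑ r ∈ Finset.range k,
        (∑ i : Fin k, δ i * (if r < (i : ℕ) then (1 : ℝ) else 0)) ^ 2 := by
    simp only [minsum_aux, mul_add, mul_one, Finset.sum_add_distrib]
    congr 1
    · rw [sq, Finset.sum_mul_sum]
    · have hr : ∀ r ∈ Finset.range k,
          (∑ i : Fin k, δ i * (if r < (i : ℕ) then (1 : ℝ) else 0)) ^ 2 =
          ∑ i : Fin k, ∑ j : Fin k, δ i * (if r < (i : ℕ) then (1 : ℝ) else 0) *
            (δ j * (if r < (j : ℕ) then (1 : ℝ) else 0)) := by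
        intro r _
        rw [sq, Finset.sum_mul_sum]
      have hsw : ∑ r ∈ Finset.range k, ∑ i : Fin k, ∑ j : Fin k,
          δ i * (if r < (i : ℕ) then (1 : ℝ) else 0) *
            (δ j * (if r < (j : ℕ) then (1 : ℝ) else 0)) =
          ∑ i : Fin k, ∑ j : Fin k, ∑ r ∈ Finset.range k,
          δ i * (if r < (i : ℕ) then (1 : ℝ) else 0) *
            (δ j * (if r < (j : ℕ) then (1 : ℝ) else 0)) := by
        rw [Finset.sum_comm]
        exact Finset.sum_congr rfl fun i _ => Finset.sum_comm
      rw [Finset.sum_congr rfl hr, hsw]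
      simp only [Finset.mul_sum]
      refine Finset.sum_congr rfl fun i _ => ?_
      refine Finset.sum_congr rfl fun j _ => ?_
      exact Finset.sum_congr rfl fun r _ => by ring
  rw [h]
  have : 0 ≤ ∑ r ∈ Finset.range k,
        (∑ i : Fin k, δ i * (if r < (i : ℕ) then (1 : ℝ) else 0)) ^ 2 :=
    Finset.sum_nonneg fun _ _ => sq_nonneg _
  linarith

section core
variable {k m : ℕ} (hk : 2 ≤ k) (x : Fin k ⊕ Fin k → ℝ) (a ρ : ℝ)

lemma pend_eq (z : Fin m → ℝ) (hx : ∀ s, 0 < x s) (hz : ∀ j, 0 < z j) (hρ : 0 < ρ) (hk : 2 ≤ k)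
    (E2 : ∀ j, ∑ t, (1 + |(ps t : ℝ)|) * x t + ∑ j', (if j = j' then (0 : ℝ) else 2) * z j'
      = ρ * z j) :
    ∃ a : ℝ, 0 < a ∧ (∀ j, z j = a) ∧
      (ρ + 2) * a = ∑ t, (1 + |(ps t : ℝ)|) * x t + 2 * m * a := by
  have hC : 0 < ∑ t, (1 + |(ps t : ℝ)|) * x t := by
    apply Finset.sum_pos
    · intro t _
      have := hx t
      positivity
    · exact ⟨Sum.inl ⟨0, by omega⟩, Finset.mem_univ _⟩
  have hZ : 0 ≤ ∑ j, z j := Finset.sum_nonneg fun j _ => (hz j).le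
  have hall : ∀ j, z j = (∑ t, (1 + |(ps t : ℝ)|) * x t + 2 * ∑ j, z j) / (ρ + 2) := by
    intro j
    rw [eq_div_iff (by linarith)]
    have h := E2 j
    have h2 : ∑ j', (if j = j' then (0 : ℝ) else 2) * z j' = 2 * ∑ j, z j - 2 * z j := by
      have : ∀ j', (if j = j' then (0 : ℝ) else 2) * z j' =
          2 * z j' - (if j = j' then 2 * z j' else 0) := by
        intro j'
        split_ifs <;> ring
      simp only [this, Finset.sum_sub_distrib, Finset.sum_ite_eq, Finset.mem_univ, if_true,
        Finset.mul_sum]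
    rw [h2] at h
    linarith
  refine ⟨_, ?_, hall, ?_⟩
  · apply div_pos <;> linarith
  · rw [mul_div_cancel₀ _ (by linarith : ρ + 2 ≠ 0)]
    congr 1
    have : ∑ j, z j = ∑ j : Fin m, (∑ t, (1 + |(ps t : ℝ)|) * x t + 2 * ∑ j, z j) / (ρ + 2) :=
      Finset.sum_congr rfl fun j _ => hall j
    rw [Finset.sum_const, Finset.card_univ, Fintype.card_fin, nsmul_eq_mul] at this
    linarith

lemma ps_inj {k : ℕ} {s t : Fin k ⊕ Fin k} (h : ps s = ps t) : s = t := by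
  rcases s with i | i <;> rcases t with j | j <;> simp [ps, Fin.ext_iff] at h ⊢ <;> omega

lemma rho_gt (hk : 2 ≤ k) (hx : ∀ s, 0 < x s) (ha : 0 < a)
    (E1 : ∀ s, ∑ t, |(ps s : ℝ) - ps t| * x t + m * a * (1 + |(ps s : ℝ)|) = ρ * x s) :
    (k : ℝ) < ρ := by
  have hX : 0 < ∑ t, x t := Finset.sum_pos (fun t _ => hx t) ⟨Sum.inl ⟨0, by omega⟩, Finset.mem_univ _⟩
  have h1 : ∑ s : Fin k ⊕ Fin k, ∑ t, |(ps s : ℝ) - ps t| * x t ≤ ρ * ∑ t, x t := by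
    rw [Finset.mul_sum]
    refine Finset.sum_le_sum fun s _ => ?_
    rw [← E1 s]
    have : 0 ≤ m * a * (1 + |(ps s : ℝ)|) := by positivity
    linarith
  have h2 : (2 * k - 1) * ∑ t, x t ≤ ∑ s : Fin k ⊕ Fin k, ∑ t, |(ps s : ℝ) - ps t| * x t := by
    rw [Finset.sum_comm, Finset.mul_sum]
    refine Finset.sum_le_sum fun t _ => ?_
    rw [← Finset.sum_mul]
    refine mul_le_mul_of_nonneg_right ?_ (hx t).le
    have : ∀ s : Fin k ⊕ Fin k, 1 - (if s = t then (1 : ℝ) else 0) ≤ |(ps s : ℝ) - ps t| := by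
      intro s
      split_ifs with h
      · simp
      · rw [sub_zero]
        have h3 : ps s - ps t ≠ 0 := fun h' => h (ps_inj (sub_eq_zero.1 h'))
        have := Int.one_le_abs h3
        exact_mod_cast this
    calc (2 * k - 1 : ℝ) = ∑ s : Fin k ⊕ Fin k, (1 - (if s = t then (1 : ℝ) else 0)) := by
          rw [Finset.sum_sub_distrib]
          simp
          ring
      _ ≤ _ := Finset.sum_le_sum fun s _ => this s
  have h3 : (2 * k - 1 : ℝ) ≤ ρ := le_of_mul_le_mul_right (h2.trans h1) hX
  have : (2 : ℝ) ≤ k := by exact_mod_cast hk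
  linarith

lemma X_gt (hk : 2 ≤ k) (hx : ∀ s, 0 < x s) (ha : 0 < a) (hρ : 0 < ρ)
    (E1 : ∀ s, ∑ t, |(ps s : ℝ) - ps t| * x t + m * a * (1 + |(ps s : ℝ)|) = ρ * x s)
    (E2 : (ρ + 2) * a = ∑ t, (1 + |(ps t : ℝ)|) * x t + 2 * m * a) :
    a < ∑ t, x t := by
  have e0 := E1 (Sum.inl ⟨0, by omega⟩)
  have e1 := E1 (Sum.inl ⟨1, by omega⟩)
  have e2 := E1 (Sum.inr ⟨0, by omega⟩)
  have p0 : ((ps (Sum.inl ⟨0, by omega⟩ : Fin k ⊕ Fin k) : ℤ) : ℝ) = 0 := by simp [ps]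
  have p1 : ((ps (Sum.inl ⟨1, by omega⟩ : Fin k ⊕ Fin k) : ℤ) : ℝ) = -1 := by simp [ps]
  have p2 : ((ps (Sum.inr ⟨0, by omega⟩ : Fin k ⊕ Fin k) : ℤ) : ℝ) = 1 := by simp [ps]
  rw [p0] at e0
  rw [p1] at e1
  rw [p2] at e2
  have hsum : ∑ t, (1 + |(ps t : ℝ)|) * x t ≤
      ∑ t, |0 - (ps t : ℝ)| * x t + ∑ t, |-1 - (ps t : ℝ)| * x t +
      ∑ t, |1 - (ps t : ℝ)| * x t := by
    rw [← Finset.sum_add_distrib, ← Finset.sum_add_distrib]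
    refine Finset.sum_le_sum fun t _ => ?_
    rw [← add_mul, ← add_mul]
    refine mul_le_mul_of_nonneg_right ?_ (hx t).le
    have h1 : |(0 : ℝ) - ps t| = |(ps t : ℝ)| := by simp
    have h2 := neg_le_abs (-1 - (ps t : ℝ))
    have h3 := le_abs_self (1 - (ps t : ℝ))
    rw [h1]
    linarith
  have hX : x (Sum.inl ⟨0, by omega⟩) + x (Sum.inl ⟨1, by omega⟩) + x (Sum.inr ⟨0, by omega⟩)
      ≤ ∑ t, x t := by
    have := Finset.sum_le_sum_of_subset_of_nonneg (f := x)
      (Finset.subset_univ ({Sum.inl ⟨0, by omega⟩, Sum.inl ⟨1, by omega⟩, Sum.inr ⟨0, by omega⟩} :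
        Finset (Fin k ⊕ Fin k))) (fun i _ _ => (hx i).le)
    rw [Finset.sum_insert (by simp), Finset.sum_insert (by simp), Finset.sum_singleton] at this
    linarith
  have hm : (0 : ℝ) ≤ m * a := by positivity
  rw [abs_zero] at e0
  rw [abs_neg, abs_one] at e1
  rw [abs_one] at e2
  have hlt : ρ * a < ρ * (x (Sum.inl ⟨0, by omega⟩) + x (Sum.inl ⟨1, by omega⟩) +
      x (Sum.inr ⟨0, by omega⟩)) := by
    rw [mul_add, mul_add, ← e0, ← e1, ← e2]
    linarith
  have := lt_of_mul_lt_mul_left hlt hρ.le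
  linarith

lemma delta_bd (hk : 2 ≤ k) (hm : 0 < m) (ha : 0 < a) (hρ : (k : ℝ) < ρ)
    (E1 : ∀ s, ∑ t, |(ps s : ℝ) - ps t| * x t + m * a * (1 + |(ps s : ℝ)|) = ρ * x s) :
    0 ≤ ∑ i, (x (Sum.inr i) - x (Sum.inl i)) ∧
      2 * ∑ i, (x (Sum.inr i) - x (Sum.inl i)) < m * a := by
  set δ : Fin k → ℝ := fun i => x (Sum.inr i) - x (Sum.inl i) with hδ
  have hk0 : (0 : ℝ) < k := by exact_mod_cast (by omega : 0 < k)
  have hma : 0 < m * a := by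
    have : (0 : ℝ) < m := by exact_mod_cast hm
    positivity
  have hrow : ∀ i, ρ * δ i = m * a - ∑ j : Fin k, δ j * ((i : ℝ) + j + 1 - |(i : ℝ) - j|) := by
    intro i
    have e1 := E1 (Sum.inr i)
    have e2 := E1 (Sum.inl i)
    simp only [hδ]
    rw [mul_sub, ← e1, ← e2]
    rw [Fintype.sum_sum_type, Fintype.sum_sum_type]
    simp only [ps]
    push_cast
    have a1 : |(i : ℝ) + 1| = i + 1 := abs_of_nonneg (by positivity)
    have a2 : |-(i : ℝ)| = i := by rw [abs_neg]; exact abs_of_nonneg (by positivity)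
    have a3 : ∀ j : Fin k, |(i : ℝ) + 1 - -j| = i + j + 1 := fun j => by
      rw [abs_of_nonneg (by have : (0:ℝ) ≤ (j : ℕ) := Nat.cast_nonneg _
                            have : (0:ℝ) ≤ (i : ℕ) := Nat.cast_nonneg _
                            linarith)]
      ring
    have a4 : ∀ j : Fin k, |-(i : ℝ) - (j + 1)| = i + j + 1 := fun j => by
      rw [abs_of_nonpos (by have : (0:ℝ) ≤ (j : ℕ) := Nat.cast_nonneg _
                            have : (0:ℝ) ≤ (i : ℕ) := Nat.cast_nonneg _
                            linarith)]
      ring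
    have a5 : ∀ j : Fin k, |(i : ℝ) + 1 - (j + 1)| = |(i : ℝ) - j| := fun j => by
      congr 1; ring
    have a6 : ∀ j : Fin k, |-(i : ℝ) - -j| = |(i : ℝ) - j| := fun j => by
      rw [← abs_neg]; congr 1; ring
    simp only [a1, a2, a3, a4, a5, a6]
    have hs : ∑ j : Fin k, (x (Sum.inr j) - x (Sum.inl j)) * ((i : ℝ) + j + 1 - |(i : ℝ) - j|) =
        (∑ j : Fin k, ((i : ℝ) + j + 1) * x (Sum.inr j) - ∑ j : Fin k, |(i : ℝ) - j| * x (Sum.inr j))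
        - (∑ j : Fin k, ((i : ℝ) + j + 1) * x (Sum.inl j)
          - ∑ j : Fin k, |(i : ℝ) - j| * x (Sum.inl j)) := by
      simp only [← Finset.sum_sub_distrib]
      exact Finset.sum_congr rfl fun j _ => by ring
    rw [hs]
    ring
  have hQ := quad_min k δ
  have hcs : (∑ i, δ i) ^ 2 ≤ k * ∑ i, δ i ^ 2 := by
    have := sq_sum_le_card_mul_sum_sq (s := (Finset.univ : Finset (Fin k))) (f := δ)
    simpa using this
  have hid : ρ * ∑ i, δ i ^ 2 + ∑ i, ∑ j : Fin k, δ i * δ j * ((i : ℝ) + j + 1 - |(i : ℝ) - j|)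
      = m * a * ∑ i, δ i := by
    rw [Finset.mul_sum, Finset.mul_sum, ← Finset.sum_add_distrib]
    refine Finset.sum_congr rfl fun i _ => ?_
    have : ∑ j : Fin k, δ i * δ j * ((i : ℝ) + j + 1 - |(i : ℝ) - j|) =
        δ i * ∑ j : Fin k, δ j * ((i : ℝ) + j + 1 - |(i : ℝ) - j|) := by
      rw [Finset.mul_sum]
      exact Finset.sum_congr rfl fun j _ => by ring
    rw [this]
    linear_combination δ i * hrow i
  set Δ := ∑ i, δ i with hΔ
  have hsq : 0 ≤ ∑ i, δ i ^ 2 := Finset.sum_nonneg fun _ _ => sq_nonneg _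
  have h0 : 0 ≤ m * a * Δ := by
    rw [← hid]
    have := sq_nonneg Δ
    have : 0 ≤ ρ * ∑ i, δ i ^ 2 := mul_nonneg (by linarith) hsq
    linarith
  have hΔ0 : 0 ≤ Δ := by
    by_contra hcon
    push Not at hcon
    nlinarith
  refine ⟨hΔ0, ?_⟩
  rcases hΔ0.eq_or_lt with h | h
  · rw [← h]; linarith
  · have h1 : (k : ℝ) * ∑ i, δ i ^ 2 ≤ ρ * ∑ i, δ i ^ 2 := mul_le_mul_of_nonneg_right hρ.le hsq
    have h2 : 2 * Δ ^ 2 ≤ m * a * Δ := by linarith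
    have h3 : 0 < ∑ i, δ i ^ 2 := by
      by_contra hcon
      have : ∑ i, δ i ^ 2 = 0 := le_antisymm (not_lt.1 hcon) hsq
      rw [this] at hcs
      have : 0 < Δ ^ 2 := by positivity
      linarith
    have h4 : (k : ℝ) * ∑ i, δ i ^ 2 < ρ * ∑ i, δ i ^ 2 := mul_lt_mul_of_pos_right hρ h3
    have h5 : 2 * Δ * Δ < m * a * Δ := by nlinarith
    exact lt_of_mul_lt_mul_right h5 h.le

lemma S_neg (hk : 2 ≤ k) (hx : ∀ s, 0 < x s)
    (hΔ : 0 ≤ ∑ i, (x (Sum.inr i) - x (Sum.inl i))) (b : ℤ) (hb : b < 0) :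
    ∑ t, |(ps t : ℝ)| * x t < ∑ t, |(b : ℝ) - ps t| * x t := by
  have hbR : (b : ℝ) < 0 := by exact_mod_cast hb
  have hx0 := hx (Sum.inl ⟨0, by omega⟩)
  have key : ∑ i : Fin k, ((b : ℝ) + i + if i = ⟨0, by omega⟩ then -2 * (b : ℝ) else 0) *
      x (Sum.inl i) + ∑ i : Fin k, (-(b : ℝ) + i + 1) * x (Sum.inr i)
      ≤ ∑ t, |(b : ℝ) - ps t| * x t := by
    rw [Fintype.sum_sum_type]
    refine add_le_add (Finset.sum_le_sum fun i _ => mul_le_mul_of_nonneg_right ?_ (hx _).le)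
      (Finset.sum_le_sum fun i _ => mul_le_mul_of_nonneg_right ?_ (hx _).le)
    · simp only [ps]
      push_cast
      split_ifs with h
      · subst h
        have := neg_le_abs ((b : ℝ) - -((0 : ℕ) : ℝ))
        simp at this ⊢
        linarith
      · have := le_abs_self ((b : ℝ) - -((i : ℕ) : ℝ))
        linarith
    · simp only [ps]
      push_cast
      have := neg_le_abs ((b : ℝ) - ((i : ℕ) + 1 : ℝ))
      linarith
  have h0 : ∑ t, |(ps t : ℝ)| * x t = ∑ i : Fin k, (i : ℝ) * x (Sum.inl i) +
      ∑ i : Fin k, ((i : ℝ) + 1) * x (Sum.inr i) := by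
    rw [Fintype.sum_sum_type]
    simp only [ps]
    push_cast
    congr 1
    · refine Finset.sum_congr rfl fun i _ => ?_
      rw [abs_neg, abs_of_nonneg (Nat.cast_nonneg _)]
    · refine Finset.sum_congr rfl fun i _ => ?_
      rw [abs_of_nonneg (by positivity)]
  have hexp : ∑ i : Fin k, ((b : ℝ) + i + if i = ⟨0, by omega⟩ then -2 * (b : ℝ) else 0) *
      x (Sum.inl i) + ∑ i : Fin k, (-(b : ℝ) + i + 1) * x (Sum.inr i) =
      (∑ i : Fin k, (i : ℝ) * x (Sum.inl i) + ∑ i : Fin k, ((i : ℝ) + 1) * x (Sum.inr i))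
      - b * ∑ i, (x (Sum.inr i) - x (Sum.inl i)) - 2 * b * x (Sum.inl ⟨0, by omega⟩) := by
    have h1 : ∑ i : Fin k, ((b : ℝ) + i + if i = ⟨0, by omega⟩ then -2 * (b : ℝ) else 0) *
      x (Sum.inl i) = ∑ i : Fin k, ((b : ℝ) + i) * x (Sum.inl i)
        - 2 * b * x (Sum.inl ⟨0, by omega⟩) := by
      simp only [add_mul _ (ite _ _ _), ite_mul, zero_mul, Finset.sum_add_distrib,
        Finset.sum_ite_eq', Finset.mem_univ, if_true]
      ring
    rw [h1]
    have h2 : ∑ i : Fin k, ((b : ℝ) + i) * x (Sum.inl i) +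
        ∑ i : Fin k, (-(b : ℝ) + i + 1) * x (Sum.inr i) =
        (∑ i : Fin k, (i : ℝ) * x (Sum.inl i) + ∑ i : Fin k, ((i : ℝ) + 1) * x (Sum.inr i))
      - b * ∑ i, (x (Sum.inr i) - x (Sum.inl i)) := by
      rw [Finset.mul_sum, ← Finset.sum_add_distrib, ← Finset.sum_add_distrib,
        ← Finset.sum_sub_distrib]
      exact Finset.sum_congr rfl fun i _ => by ring
    linarith
  rw [h0]
  nlinarith

lemma S_pos (hx : ∀ s, 0 < x s) (b : ℤ) (hb : 0 < b) :
    ∑ t, |(ps t : ℝ)| * x t - b * ∑ i, (x (Sum.inr i) - x (Sum.inl i))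
      ≤ ∑ t, |(b : ℝ) - ps t| * x t := by
  have hbR : (0 : ℝ) < b := by exact_mod_cast hb
  rw [Fintype.sum_sum_type, Fintype.sum_sum_type, Finset.mul_sum, ← Finset.sum_add_distrib,
    ← Finset.sum_add_distrib, ← Finset.sum_sub_distrib]
  refine Finset.sum_le_sum fun i _ => ?_
  simp only [ps]
  push_cast
  have hi : (0 : ℝ) ≤ (i : ℕ) := Nat.cast_nonneg _
  rw [abs_neg, abs_of_nonneg hi, abs_of_nonneg (by linarith : (0 : ℝ) ≤ (i : ℕ) + 1)]
  have h1 := le_abs_self ((b : ℝ) - -((i : ℕ) : ℝ))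
  have h2 := neg_le_abs ((b : ℝ) - ((i : ℕ) + 1 : ℝ))
  have m1 := mul_le_mul_of_nonneg_right h1 (hx (Sum.inl i)).le
  have m2 := mul_le_mul_of_nonneg_right h2 (hx (Sum.inr i)).le
  linarith

end core

lemma split2 {A B : Type*} [Fintype A] [Fintype B] (F : A ⊕ B → A ⊕ B → ℝ) :
    ∑ i, ∑ j, F i j = ∑ s, ∑ t, F (Sum.inl s) (Sum.inl t) +
      ∑ j, ∑ s, F (Sum.inl s) (Sum.inr j) +
      (∑ j, ∑ s, F (Sum.inr j) (Sum.inl s) + ∑ j, ∑ j', F (Sum.inr j) (Sum.inr j')) := by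
  rw [Finset.sum_comm (f := fun j s => F (Sum.inl s) (Sum.inr j))]
  simp only [Fintype.sum_sum_type, Finset.sum_add_distrib]
  ring

lemma core_s8 {V : Type*} {T : SimpleGraph V} {k m : ℕ} (hk : 2 ≤ k) (D : TData T k m)
    (hp : (m : ℝ) ≤ 2 * ∑ j, (if D.b j ≤ 0 then (1 : ℝ) else 0))
    (x : Fin k ⊕ Fin k → ℝ) (a ρ : ℝ) (hx : ∀ s, 0 < x s) (ha : 0 < a) (hρ : 0 < ρ)
    (E1 : ∀ s, ∑ t, |(ps s : ℝ) - ps t| * x t + m * a * (1 + |(ps s : ℝ)|) = ρ * x s)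
    (E2 : (ρ + 2) * a = ∑ t, (1 + |(ps t : ℝ)|) * x t + 2 * m * a)
    (y : (Fin k ⊕ Fin k) ⊕ Fin m → ℝ) (hyx : ∀ s, y (Sum.inl s) = x s)
    (hya : ∀ j, y (Sum.inr j) = a) :
    (∑ i, ∑ j, (d1 i j : ℝ) * y i * y j ≤
      ∑ i, ∑ j, (T.dist (D.e i) (D.e j) : ℝ) * y i * y j) ∧
    (∑ i, ∑ j, (T.dist (D.e i) (D.e j) : ℝ) * y i * y j ≤ ∑ i, ∑ j, (d1 i j : ℝ) * y i * y j →
      ∀ j, D.h j = 1 ∧ D.b j = 0) := by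
  have hρk := rho_gt (m := m) x a ρ hk hx ha E1
  have hXa := X_gt (m := m) x a ρ hk hx ha hρ E1 E2
  set X := ∑ t, x t with hXdef
  set S0 := ∑ t, |(ps t : ℝ)| * x t with hS0
  set p := ∑ j, (if D.b j ≤ 0 then (1 : ℝ) else 0) with hpdef
  set τ : Fin m → ℝ := fun j => ((D.h j : ℝ) - 1) * (X - a) +
    (∑ t, |(D.b j : ℝ) - ps t| * x t - S0) + a * p * (if 0 < D.b j then (D.b j : ℝ) else 0)
    with hτ
  -- difference of the two quadratic forms
  have hdist1 : ∀ s t, (T.dist (D.e (Sum.inl s)) (D.e (Sum.inl t)) : ℝ) = |(ps s : ℝ) - ps t| := by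
    intro s t
    exact_mod_cast D.c1 s t
  have hdist2 : ∀ j s, (T.dist (D.e (Sum.inr j)) (D.e (Sum.inl s)) : ℝ) =
      D.h j + |(D.b j : ℝ) - ps s| := by
    intro j s
    exact_mod_cast D.c2 j s
  have hdist3 : ∀ j s, (T.dist (D.e (Sum.inl s)) (D.e (Sum.inr j)) : ℝ) =
      D.h j + |(D.b j : ℝ) - ps s| := by
    intro j s
    rw [SimpleGraph.dist_comm]
    exact hdist2 j s
  have hdiff : ∑ i, ∑ j, (T.dist (D.e i) (D.e j) : ℝ) * y i * y j
      - ∑ i, ∑ j, (d1 i j : ℝ) * y i * y j =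
      2 * a * ∑ j, (((D.h j : ℝ) - 1) * X + (∑ t, |(D.b j : ℝ) - ps t| * x t - S0)) +
      a ^ 2 * ∑ j : Fin m, ∑ j' : Fin m,
        ((T.dist (D.e (Sum.inr j)) (D.e (Sum.inr j')) : ℝ) - (if j = j' then (0 : ℝ) else 2)) := by
    have hone : ∀ j, ((D.h j : ℝ) - 1) * X + (∑ t, |(D.b j : ℝ) - ps t| * x t - S0) =
        ∑ t, ((D.h j + |(D.b j : ℝ) - ps t|) - (1 + |(ps t : ℝ)|)) * x t := by
      intro j
      rw [hXdef, hS0, Finset.mul_sum, ← Finset.sum_sub_distrib, ← Finset.sum_add_distrib]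
      exact Finset.sum_congr rfl fun t _ => by ring
    simp only [hone]
    rw [← Finset.sum_sub_distrib]
    simp only [← Finset.sum_sub_distrib]
    rw [split2]
    simp only [hdist1, hdist2, hdist3, hyx, hya, d1]
    push_cast
    simp only [sub_self, Finset.sum_const_zero, zero_add]
    rw [← add_assoc]
    congr 1
    · rw [two_mul, add_mul, Finset.mul_sum]
      congr 1 <;>
      · refine Finset.sum_congr rfl fun j _ => ?_
        rw [Finset.mul_sum]
        exact Finset.sum_congr rfl fun t _ => by ring
    · rw [Finset.mul_sum]
      refine Finset.sum_congr rfl fun j _ => ?_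
      rw [Finset.mul_sum]
      exact Finset.sum_congr rfl fun t _ => by ring
  -- lower bound for the pendant-pendant part
  have hpp : 2 * p * ∑ j, (if 0 < D.b j then (D.b j : ℝ) else 0) - 2 * ∑ j, ((D.h j : ℝ) - 1) ≤
      ∑ j : Fin m, ∑ j' : Fin m,
        ((T.dist (D.e (Sum.inr j)) (D.e (Sum.inr j')) : ℝ) - (if j = j' then (0 : ℝ) else 2)) := by
    have hpt : ∀ j j' : Fin m,
        (if D.b j ≤ 0 then (1 : ℝ) else 0) * (if 0 < D.b j' then (D.b j' : ℝ) else 0) +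
        (if 0 < D.b j then (D.b j : ℝ) else 0) * (if D.b j' ≤ 0 then (1 : ℝ) else 0)
        - D.par j j' - D.par j' j ≤
        ((T.dist (D.e (Sum.inr j)) (D.e (Sum.inr j')) : ℝ) - (if j = j' then (0 : ℝ) else 2)) := by
      intro j j'
      have hpar : (0 : ℝ) ≤ D.par j j' := by exact_mod_cast D.c5 j j'
      have hpar' : (0 : ℝ) ≤ D.par j' j := by exact_mod_cast D.c5 j' j
      have hb : (if D.b j ≤ 0 then (1 : ℝ) else 0) * (if 0 < D.b j' then (D.b j' : ℝ) else 0) +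
        (if 0 < D.b j then (D.b j : ℝ) else 0) * (if D.b j' ≤ 0 then (1 : ℝ) else 0) ≤
          |(D.b j : ℝ) - D.b j'| := by
        have u1 := le_abs_self ((D.b j : ℝ) - D.b j')
        have u2 := neg_le_abs ((D.b j : ℝ) - D.b j')
        by_cases h1 : D.b j ≤ 0
        · have h1R : (D.b j : ℝ) ≤ 0 := by exact_mod_cast h1
          rw [if_pos h1, if_neg (not_lt.2 h1)]
          by_cases h2 : 0 < D.b j'
          · rw [if_pos h2]
            linarith
          · rw [if_neg h2]
            simp
        · have h1' : 0 < D.b j := not_le.1 h1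
          rw [if_neg h1, if_pos h1']
          by_cases h2 : D.b j' ≤ 0
          · have h2R : (D.b j' : ℝ) ≤ 0 := by exact_mod_cast h2
            rw [if_pos h2]
            linarith
          · rw [if_neg h2]
            simp
      by_cases hjj : j = j'
      · subst hjj
        simp only [sub_self, abs_zero] at hb
        rw [if_pos rfl, SimpleGraph.dist_self]
        push_cast
        linarith
      · have h4 : (2 : ℝ) + |(D.b j : ℝ) - D.b j'| - D.par j j' - D.par j' j ≤
            (T.dist (D.e (Sum.inr j)) (D.e (Sum.inr j')) : ℝ) := by
          exact_mod_cast D.c4 j j' hjj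
        rw [if_neg hjj]
        linarith
    refine le_trans ?_ (Finset.sum_le_sum fun j _ => Finset.sum_le_sum fun j' _ => hpt j j')
    have hc6 : ∑ j, ∑ j', (D.par j j' : ℝ) ≤ ∑ j, ((D.h j : ℝ) - 1) := by
      refine Finset.sum_le_sum fun j _ => ?_
      exact_mod_cast D.c6 j
    have hc6' : ∑ j, ∑ j', (D.par j' j : ℝ) ≤ ∑ j, ((D.h j : ℝ) - 1) := by
      rw [Finset.sum_comm]
      exact hc6
    simp only [Finset.sum_sub_distrib, Finset.sum_add_distrib] at hc6 hc6' ⊢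
    rw [← Finset.sum_mul_sum, ← Finset.sum_mul_sum, ← hpdef]
    linarith
  have hlow : 2 * a * ∑ j, τ j ≤ ∑ i, ∑ j, (T.dist (D.e i) (D.e j) : ℝ) * y i * y j
      - ∑ i, ∑ j, (d1 i j : ℝ) * y i * y j := by
    rw [hdiff]
    have h1 := mul_le_mul_of_nonneg_left hpp (sq_nonneg a)
    have h2 : ∑ j, τ j = ∑ j, (((D.h j : ℝ) - 1) * X + (∑ t, |(D.b j : ℝ) - ps t| * x t - S0))
        - a * ∑ j, ((D.h j : ℝ) - 1) + a * p * ∑ j, (if 0 < D.b j then (D.b j : ℝ) else 0) := by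
      rw [Finset.mul_sum, Finset.mul_sum, ← Finset.sum_sub_distrib, ← Finset.sum_add_distrib]
      exact Finset.sum_congr rfl fun j _ => by simp only [hτ]; ring
    rw [h2]
    linarith
  have hτj : ∀ j, 0 ≤ τ j ∧ (τ j ≤ 0 → D.h j = 1 ∧ D.b j = 0) := by
    intro j
    have hm : 0 < m := Nat.lt_of_le_of_lt (Nat.zero_le _) j.2
    obtain ⟨hΔ0, hΔ1⟩ := delta_bd (m := m) x a ρ hk hm ha hρk E1
    have hhR : (1 : ℝ) ≤ D.h j := by exact_mod_cast D.c3 j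
    have t1 : 0 ≤ ((D.h j : ℝ) - 1) * (X - a) := mul_nonneg (by linarith) (by linarith)
    have t1' : ((D.h j : ℝ) - 1) * (X - a) ≤ 0 → D.h j = 1 := by
      intro h
      have : (D.h j : ℝ) - 1 ≤ 0 := by
        by_contra hcon
        push Not at hcon
        have : 0 < ((D.h j : ℝ) - 1) * (X - a) := mul_pos hcon (by linarith)
        linarith
      have : (D.h j : ℝ) = 1 := by linarith
      exact_mod_cast this
    rcases lt_trichotomy (D.b j) 0 with hb | hb | hb
    · have hS := S_neg x hk hx hΔ0 (D.b j) hb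
      have : τ j = ((D.h j : ℝ) - 1) * (X - a) + (∑ t, |(D.b j : ℝ) - ps t| * x t - S0) := by
        simp only [hτ]
        rw [if_neg (by omega)]
        ring
      rw [this]
      exact ⟨by linarith, fun h => by exfalso; linarith⟩
    · have : τ j = ((D.h j : ℝ) - 1) * (X - a) := by
        simp only [hτ]
        rw [hb]
        simp [hS0]
      rw [this]
      exact ⟨t1, fun h => ⟨t1' h, hb⟩⟩
    · have hS := S_pos x hx (D.b j) hb
      have hbR : (0 : ℝ) < D.b j := by exact_mod_cast hb
      have : τ j = ((D.h j : ℝ) - 1) * (X - a) + (∑ t, |(D.b j : ℝ) - ps t| * x t - S0)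
          + a * p * D.b j := by
        simp only [hτ]
        rw [if_pos hb]
      rw [this]
      have hap : 0 < a * p - ∑ i, (x (Sum.inr i) - x (Sum.inl i)) := by nlinarith
      have := mul_pos hap hbR
      exact ⟨by nlinarith, fun h => by exfalso; nlinarith⟩
  have hsum : 0 ≤ ∑ j, τ j := Finset.sum_nonneg fun j _ => (hτj j).1
  refine ⟨?_, ?_⟩
  · have : 0 ≤ 2 * a * ∑ j, τ j := by positivity
    linarith
  · intro hle j
    apply (hτj j).2
    have h1 : 2 * a * ∑ j, τ j ≤ 0 := by linarith
    have h2 : ∑ j, τ j ≤ 0 := by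
      by_contra hcon
      push Not at hcon
      have : 0 < 2 * a * ∑ j, τ j := by positivity
      linarith
    exact (Finset.single_le_sum (fun j _ => (hτj j).1) (Finset.mem_univ j)).trans h2

lemma t1_d1 {k m : ℕ} (hk : 2 ≤ k) (a b : (Fin k ⊕ Fin k) ⊕ Fin m) :
    ((treeT1 k m).dist (Equiv.sumAssoc _ _ _ a) (Equiv.sumAssoc _ _ _ b) : ℤ) = d1 a b := by
  rw [(t1_dist hk _ _).2]
  rcases a with (i | i) | i <;> rcases b with (j | j) | j <;>
    simp [t1F, t1pos, t1ht, d1, ps, Fin.ext_iff] <;> grind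

lemma exists_good {V : Type*} [Fintype V] {T : SimpleGraph V} (hT : T.IsTree) {k m : ℕ}
    (hk : 2 ≤ k) (hcard : Fintype.card V = 2 * k + m) (hdiam : T.diam = 2 * k - 1) :
    ∃ D : TData T k m, (m : ℝ) ≤ 2 * ∑ j, (if D.b j ≤ 0 then (1 : ℝ) else 0) := by
  obtain ⟨D⟩ := exists_tdata hT hk hcard hdiam
  have hs : ∑ j, (if D.b j ≤ 0 then (1 : ℝ) else 0) +
      ∑ j, (if D.flip.b j ≤ 0 then (1 : ℝ) else 0) = m := by
    rw [← Finset.sum_add_distrib]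
    have : ∀ j : Fin m, (if D.b j ≤ 0 then (1 : ℝ) else 0) +
        (if D.flip.b j ≤ 0 then (1 : ℝ) else 0) = 1 := by
      intro j
      have hf : D.flip.b j = 1 - D.b j := rfl
      rw [hf]
      by_cases h : D.b j ≤ 0
      · rw [if_pos h, if_neg (by omega)]; norm_num
      · rw [if_neg h, if_pos (by omega)]; norm_num
    simp only [this]
    simp
  by_cases h : (m : ℝ) ≤ 2 * ∑ j, (if D.b j ≤ 0 then (1 : ℝ) else 0)
  · exact ⟨D, h⟩
  · exact ⟨D.flip, by linarith⟩

lemma main_aux {V : Type*} [Fintype V] {T : SimpleGraph V} (hT : T.IsTree) {k m : ℕ}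
    (hk : 2 ≤ k) (hcard : Fintype.card V = 2 * k + m) (hdiam : T.diam = 2 * k - 1) :
    distSpectralRadius (treeT1 k m) ≤ distSpectralRadius T ∧
    (distSpectralRadius T ≤ distSpectralRadius (treeT1 k m) → Nonempty (T ≃g treeT1 k m)) := by
  obtain ⟨D, hp⟩ := exists_good hT hk hcard hdiam
  have : Nontrivial (Fin k ⊕ (Fin k ⊕ Fin m)) :=
    ⟨Sum.inl ⟨0, by omega⟩, Sum.inr (Sum.inl ⟨0, by omega⟩), by simp⟩
  obtain ⟨y0, hy0, hE0⟩ := exists_perron (treeT1 k m) (t1_connected hk)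
  set ρ := distSpectralRadius (treeT1 k m) with hρdef
  let α : (Fin k ⊕ Fin k) ⊕ Fin m ≃ Fin k ⊕ (Fin k ⊕ Fin m) := Equiv.sumAssoc _ _ _
  let y : (Fin k ⊕ Fin k) ⊕ Fin m → ℝ := fun i => y0 (α i)
  have hdR : ∀ i j, ((treeT1 k m).dist (α i) (α j) : ℝ) = (d1 i j : ℝ) := by
    intro i j
    exact_mod_cast t1_d1 hk i j
  have hE : ∀ i, ∑ j, (d1 i j : ℝ) * y j = ρ * y i := by
    intro i
    rw [← hE0 (α i), ← α.sum_comp]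
    exact Finset.sum_congr rfl fun j _ => by rw [hdR]
  have hy : ∀ i, 0 < y i := fun i => hy0 _
  have hρ : 0 < ρ := by
    have h := hE (Sum.inl (Sum.inl ⟨0, by omega⟩))
    have hpos : 0 < ∑ j, (d1 (Sum.inl (Sum.inl ⟨0, by omega⟩) : (Fin k ⊕ Fin k) ⊕ Fin m) j : ℝ)
        * y j := by
      apply Finset.sum_pos'
      · intro j _
        rw [← hdR]
        exact mul_nonneg (Nat.cast_nonneg _) (hy j).le
      · refine ⟨Sum.inl (Sum.inr ⟨0, by omega⟩), Finset.mem_univ _, ?_⟩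
        apply mul_pos _ (hy _)
        simp [d1, ps]
    rw [h] at hpos
    exact (mul_pos_iff_of_pos_right (hy _)).1 hpos
  obtain ⟨a, ha, hza, E2⟩ := pend_eq (k := k) (m := m) (fun s => y (Sum.inl s)) ρ
    (fun j => y (Sum.inr j)) (fun s => hy _) (fun j => hy _) hρ hk (by
      intro j
      have := hE (Sum.inr j)
      rw [Fintype.sum_sum_type] at this
      simp only [d1] at this
      push_cast at this
      exact this)
  have E1 : ∀ s, ∑ t, |(ps s : ℝ) - ps t| * y (Sum.inl t) + m * a * (1 + |(ps s : ℝ)|)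
      = ρ * y (Sum.inl s) := by
    intro s
    have := hE (Sum.inl s)
    rw [Fintype.sum_sum_type] at this
    simp only [d1, hza] at this
    push_cast at this
    rw [Finset.sum_const, Finset.card_univ, Fintype.card_fin, nsmul_eq_mul] at this
    linarith
  obtain ⟨hle, heq⟩ := core_s8 hk D hp (fun s => y (Sum.inl s)) a ρ (fun s => hy _) ha hρ E1 E2 y
    (fun _ => rfl) hza
  have hQ1 : ∑ i, ∑ j, (d1 i j : ℝ) * y i * y j = ρ * ∑ i, y i ^ 2 := by
    rw [Finset.mul_sum]
    refine Finset.sum_congr rfl fun i _ => ?_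
    calc ∑ j, (d1 i j : ℝ) * y i * y j = y i * ∑ j, (d1 i j : ℝ) * y j := by
          rw [Finset.mul_sum]
          exact Finset.sum_congr rfl fun j _ => by ring
      _ = _ := by rw [hE]; ring
  have hQT : ∑ i, ∑ j, (T.dist (D.e i) (D.e j) : ℝ) * y i * y j ≤
      distSpectralRadius T * ∑ i, y i ^ 2 := by
    have := rayleigh T (fun v => y (D.e.symm v))
    rw [← D.e.sum_comp, ← D.e.sum_comp] at this
    simp only [Equiv.symm_apply_apply] at this
    refine le_trans (le_of_eq ?_) this
    refine Finset.sum_congr rfl fun i _ => ?_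
    rw [← D.e.sum_comp]
    simp
  have hY : 0 < ∑ i, y i ^ 2 :=
    Finset.sum_pos (fun i _ => pow_pos (hy i) 2)
      ⟨Sum.inl (Sum.inl ⟨0, by omega⟩), Finset.mem_univ _⟩
  refine ⟨?_, ?_⟩
  · rw [hQ1] at hle
    exact le_of_mul_le_mul_right (hle.trans hQT) hY
  · intro hTle
    have hall := heq (by
      rw [hQ1]
      exact hQT.trans (mul_le_mul_of_nonneg_right hTle hY.le))
    have hdd : ∀ i j, (T.dist (D.e i) (D.e j) : ℤ) = d1 i j := by
      have h2 : ∀ j s, (T.dist (D.e (Sum.inr j)) (D.e (Sum.inl s)) : ℤ) = 1 + |ps s| := by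
        intro j s
        rw [D.c2, (hall j).1, (hall j).2, zero_sub, abs_neg]
      intro i j
      rcases i with s | i <;> rcases j with t | j
      · exact D.c1 s t
      · rw [SimpleGraph.dist_comm, h2]
        rfl
      · rw [h2]
        rfl
      · simp only [d1]
        by_cases hij : i = j
        · subst hij
          simp
        · rw [if_neg hij]
          have hpar : ∀ i j, D.par i j = 0 := by
            intro i j
            have h6 := D.c6 i
            rw [(hall i).1, sub_self] at h6
            have h7 := Finset.single_le_sum (fun j _ => D.c5 i j) (Finset.mem_univ j)
            have h8 := D.c5 i j
            omega
          have h4 := D.c4 i j hij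
          rw [hpar, hpar, (hall i).2, (hall j).2] at h4
          simp at h4
          have h9 := hT.connected.dist_triangle (u := D.e (Sum.inr i))
            (v := D.e (Sum.inl (Sum.inl ⟨0, by omega⟩))) (w := D.e (Sum.inr j))
          have ha1 := h2 i (Sum.inl ⟨0, by omega⟩)
          have ha2 := h2 j (Sum.inl ⟨0, by omega⟩)
          rw [SimpleGraph.dist_comm] at ha2
          have hz : ps (Sum.inl ⟨0, by omega⟩ : Fin k ⊕ Fin k) = 0 := by simp [ps]
          rw [hz, abs_zero] at ha1 ha2
          omega
    refine ⟨⟨D.e.symm.trans α, ?_⟩⟩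
    intro u v
    rw [← SimpleGraph.dist_eq_one_iff_adj, ← SimpleGraph.dist_eq_one_iff_adj]
    have h1 := hdd (D.e.symm u) (D.e.symm v)
    have h2 := t1_d1 (m := m) hk (D.e.symm u) (D.e.symm v)
    simp only [Equiv.apply_symm_apply] at h1
    rw [← h1] at h2
    have h3 : (treeT1 k m).dist ((D.e.symm.trans α) u) ((D.e.symm.trans α) v) = T.dist u v := by
      exact_mod_cast h2
    rw [h3]

/-- Main theorem (odd diameter): among all trees on `n` vertices with diameter `2k - 1`
(`k ≥ 2`), the distance spectral radius is minimized uniquely by the tree `T₁` obtained by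
attaching `n - 2k` pendant vertices at `v_1` of the path `v_k ⋯ v_1 u_1 ⋯ u_k`. -/
theorem stmt8 {V : Type*} [Fintype V] (n k : ℕ) (hk : 2 ≤ k) (h2k : 2 * k ≤ n)
    (T : SimpleGraph V) (hcard : Fintype.card V = n)
    (hconn : T.Connected) (hacyc : T.IsAcyclic) (hdiam : T.diam = 2 * k - 1) :
    distSpectralRadius T ≥ distSpectralRadius (treeT1 k (n - 2 * k)) ∧
    (distSpectralRadius T = distSpectralRadius (treeT1 k (n - 2 * k)) ↔
      Nonempty (T ≃g treeT1 k (n - 2 * k))) := by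
  have hT : T.IsTree := ⟨hconn, hacyc⟩
  obtain ⟨h1, h2⟩ := main_aux hT (m := n - 2 * k) hk (by omega) hdiam
  refine ⟨h1, fun h => h2 h.le, ?_⟩
  rintro ⟨e⟩
  exact iso_radius (t1_connected hk) hconn e
end
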